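/- arXiv:2009.05850 — 2 statements merged into one kernel-verified Lean document; each statement's English description precedes it below -/
import Mathlib

section
/- Fix s ∈ [0,1] with s ≠ 1/2 and consider the cone of completely positive maps on M_N(ℂ) that are self-adjoint with respect to the inner product ⟨B,A⟩_{δ_s} = Tr[B* σ^s A σ^{1−s}]. The extremal rays of this cone are precisely the maps of the form Φ(A) = e^{ω/2} V* A V + e^{−ω/2} V A V*, where σ V σ^{−1} = e^{ω} V for some ω > 0, together with the maps Φ(A) = V A V where σ V σ^{−1} = V and V = V*. In particular, every completely positive map self-adjoint with respect to ⟨·,·⟩_{δ_s} is a positive linear combination of maps of these two forms. -/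
open MeasureTheory Matrix
open scoped ComplexOrder

noncomputable section

/-- The algebra of `N × N` complex matrices. -/
abbrev Mat (N : ℕ) := Matrix (Fin N) (Fin N) ℂ

variable {N : ℕ}

/-- Real power `σ^s` of a positive definite matrix, defined via the spectral decomposition. -/
noncomputable def mpow (σ : Mat N) (hσ : σ.PosDef) (s : ℝ) : Mat N :=
  (hσ.1.eigenvectorUnitary : Mat N) *
    Matrix.diagonal (fun i => ((hσ.1.eigenvalues i ^ s : ℝ) : ℂ)) *
    star (hσ.1.eigenvectorUnitary : Mat N)

/-- Complete positivity of a linear map on `M_N(ℂ)`: existence of a Kraus representation. -/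
def IsCP (Φ : Mat N →ₗ[ℂ] Mat N) : Prop :=
  ∃ (M : ℕ) (V : Fin M → Mat N), ∀ A, Φ A = ∑ j, (V j)ᴴ * A * V j

/-- The KMS inner product `⟨B,A⟩_KMS = Tr[Bᴴ σ^{1/2} A σ^{1/2}]`. -/
def kmsInner (σ : Mat N) (hσ : σ.PosDef) (B A : Mat N) : ℂ :=
  (Bᴴ * mpow σ hσ (1/2) * A * mpow σ hσ (1/2)).trace

/-- Self-adjointness with respect to the KMS inner product. -/
def IsKMSSelfAdjoint (σ : Mat N) (hσ : σ.PosDef) (Φ : Mat N →ₗ[ℂ] Mat N) : Prop :=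
  ∀ A B, kmsInner σ hσ B (Φ A) = kmsInner σ hσ (Φ B) A

/-- The inner product `⟨B,A⟩_{δ_s} = Tr[Bᴴ σ^s A σ^{1-s}]`. -/
def dsInner (σ : Mat N) (hσ : σ.PosDef) (s : ℝ) (B A : Mat N) : ℂ :=
  (Bᴴ * mpow σ hσ s * A * mpow σ hσ (1 - s)).trace

/-- Self-adjointness with respect to `⟨·,·⟩_{δ_s}`. -/
def IsDsSelfAdjoint (σ : Mat N) (hσ : σ.PosDef) (s : ℝ) (Φ : Mat N →ₗ[ℂ] Mat N) : Prop :=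
  ∀ A B, dsInner σ hσ s B (Φ A) = dsInner σ hσ s (Φ B) A

/-- `Φ(A) = e^{ω/2} Vᴴ A V + e^{-ω/2} V A Vᴴ` with `σ V σ⁻¹ = e^ω V`, `ω > 0`. -/
def FormOne (σ : Mat N) (Φ : Mat N →ₗ[ℂ] Mat N) : Prop :=
  ∃ (V : Mat N) (ω : ℝ), 0 < ω ∧ σ * V * σ⁻¹ = (Real.exp ω : ℂ) • V ∧
    ∀ A, Φ A = (Real.exp (ω / 2) : ℂ) • (Vᴴ * A * V) +
      (Real.exp (-(ω / 2)) : ℂ) • (V * A * Vᴴ)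

/-- `Φ(A) = V A V` with `σ V σ⁻¹ = V` and `V = Vᴴ`. -/
def FormTwo (σ : Mat N) (Φ : Mat N →ₗ[ℂ] Mat N) : Prop :=
  ∃ V : Mat N, σ * V * σ⁻¹ = V ∧ Vᴴ = V ∧ ∀ A, Φ A = V * A * V

/-- The elementary Kraus map `A ↦ Vᴴ A V`. -/
def kr (V : Mat N) : Mat N →ₗ[ℂ] Mat N where
  toFun A := Vᴴ * A * V
  map_add' A B := by simp [mul_add, add_mul]
  map_smul' c A := by simp

lemma kr_apply (V A : Mat N) : kr V A = Vᴴ * A * V := rfl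

lemma kr_zero : kr (0 : Mat N) = 0 := by
  ext1 A; simp [kr_apply]

lemma kr_smul (c : ℂ) (V : Mat N) : kr (c • V) = ((‖c‖ ^ 2 : ℝ) : ℂ) • kr V := by
  refine LinearMap.ext fun A => ?_
  simp only [kr_apply, LinearMap.smul_apply, conjTranspose_smul, Matrix.smul_mul, Matrix.mul_smul,
    smul_smul]
  congr 1
  rw [← Complex.normSq_eq_norm_sq, Complex.normSq_eq_conj_mul_self, mul_comm]
  rfl

lemma isCP_iff (Φ : Mat N →ₗ[ℂ] Mat N) :
    IsCP Φ ↔ ∃ (M : ℕ) (V : Fin M → Mat N), Φ = ∑ j, kr (V j) := by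
  constructor
  · rintro ⟨M, V, h⟩
    refine ⟨M, V, LinearMap.ext fun A => ?_⟩
    rw [h]; simp [LinearMap.sum_apply, kr_apply]
  · rintro ⟨M, V, h⟩
    refine ⟨M, V, fun A => ?_⟩
    rw [h]; simp [LinearMap.sum_apply, kr_apply]

lemma IsCP.zero : IsCP (0 : Mat N →ₗ[ℂ] Mat N) :=
  (isCP_iff _).2 ⟨0, Fin.elim0, by simp⟩

lemma IsCP.kr (V : Mat N) : IsCP (kr V) :=
  (isCP_iff _).2 ⟨1, fun _ => V, by simp⟩

lemma IsCP.add {Φ Ψ : Mat N →ₗ[ℂ] Mat N} (h : IsCP Φ) (h' : IsCP Ψ) : IsCP (Φ + Ψ) := by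
  rw [isCP_iff] at *
  obtain ⟨m, V, rfl⟩ := h
  obtain ⟨n, W, rfl⟩ := h'
  exact ⟨m + n, Fin.append V W, by simp [Fin.sum_univ_add]⟩

lemma IsCP.smul {Φ : Mat N →ₗ[ℂ] Mat N} (h : IsCP Φ) {c : ℝ} (hc : 0 ≤ c) :
    IsCP ((c : ℂ) • Φ) := by
  rw [isCP_iff] at *
  obtain ⟨m, V, rfl⟩ := h
  refine ⟨m, fun j => (Real.sqrt c : ℂ) • V j, ?_⟩
  simp only [kr_smul, Finset.smul_sum]
  refine Finset.sum_congr rfl fun j _ => ?_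
  rw [Complex.norm_real, Real.norm_of_nonneg (Real.sqrt_nonneg c), Real.sq_sqrt hc]

lemma formOne_iff (σ : Mat N) (hσ : σ.PosDef) (Φ : Mat N →ₗ[ℂ] Mat N) :
    FormOne σ Φ ↔ ∃ (V : Mat N) (ω : ℝ), 0 < ω ∧ σ * V = (Real.exp ω : ℂ) • (V * σ) ∧
      Φ = (Real.exp (ω / 2) : ℂ) • kr V + (Real.exp (-(ω / 2)) : ℂ) • kr Vᴴ := by
  have hu : IsUnit σ.det := (Matrix.isUnit_iff_isUnit_det _).1 hσ.isUnit
  unfold FormOne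
  refine exists_congr fun V => exists_congr fun ω => and_congr_right fun _ => and_congr ?_ ?_
  · constructor
    · intro h
      rw [← Matrix.smul_mul, ← h, Matrix.mul_assoc, Matrix.nonsing_inv_mul _ hu, Matrix.mul_one]
    · intro h
      rw [h, Matrix.smul_mul, Matrix.mul_assoc, Matrix.mul_nonsing_inv _ hu, Matrix.mul_one]
  · rw [LinearMap.ext_iff]
    simp [kr_apply]

lemma formTwo_iff (σ : Mat N) (hσ : σ.PosDef) (Φ : Mat N →ₗ[ℂ] Mat N) :
    FormTwo σ Φ ↔ ∃ V : Mat N, σ * V = V * σ ∧ Vᴴ = V ∧ Φ = kr V := by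
  have hu : IsUnit σ.det := (Matrix.isUnit_iff_isUnit_det _).1 hσ.isUnit
  unfold FormTwo
  refine exists_congr fun V => and_congr ?_ (and_congr_right fun hV => ?_)
  · constructor
    · intro h
      nth_rw 2 [← h]
      rw [Matrix.mul_assoc, Matrix.nonsing_inv_mul _ hu, Matrix.mul_one]
    · intro h
      rw [h, Matrix.mul_assoc, Matrix.mul_nonsing_inv _ hu, Matrix.mul_one]
  · rw [LinearMap.ext_iff]
    simp [kr_apply, hV]

/-! ### Real powers -/

lemma mpow_mul_neg (σ : Mat N) (hσ : σ.PosDef) (r : ℝ) : mpow σ hσ r * mpow σ hσ (-r) = 1 := by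
  unfold mpow
  set U := hσ.1.eigenvectorUnitary
  have h1 : star (U : Mat N) * (U : Mat N) = 1 := Unitary.coe_star_mul_self U
  have h2 : (U : Mat N) * star (U : Mat N) = 1 := Unitary.coe_mul_star_self U
  calc _ = (U : Mat N) * (Matrix.diagonal (fun i => ((hσ.1.eigenvalues i ^ r : ℝ) : ℂ)) *
        (star (U : Mat N) * (U : Mat N)) *
        Matrix.diagonal (fun i => ((hσ.1.eigenvalues i ^ (-r) : ℝ) : ℂ))) * star (U : Mat N) := by
        simp only [Matrix.mul_assoc]
    _ = _ := by
        rw [h1, Matrix.mul_one, Matrix.diagonal_mul_diagonal]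
        have : (fun i => ((hσ.1.eigenvalues i ^ r : ℝ) : ℂ) *
          ((hσ.1.eigenvalues i ^ (-r) : ℝ) : ℂ)) = fun _ => 1 := by
          funext i
          rw [← Complex.ofReal_mul, ← Real.rpow_add (hσ.eigenvalues_pos i)]
          simp
        rw [this, Matrix.diagonal_one, Matrix.mul_one, h2]

lemma spec (σ : Mat N) (hσ : σ.PosDef) :
    σ = (hσ.1.eigenvectorUnitary : Mat N) *
    Matrix.diagonal (fun i => ((hσ.1.eigenvalues i : ℝ) : ℂ)) *
    star (hσ.1.eigenvectorUnitary : Mat N) := by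
  have := hσ.1.spectral_theorem
  rw [Unitary.conjStarAlgAut_apply] at this
  exact this

lemma mpow_comm (σ : Mat N) (hσ : σ.PosDef) (r : ℝ) (X : Mat N) (μ : ℝ) (hμ : 0 < μ)
    (h : σ * X = (μ : ℂ) • (X * σ)) :
    mpow σ hσ r * X = ((μ ^ r : ℝ) : ℂ) • (X * mpow σ hσ r) := by
  have hs := spec σ hσ
  unfold mpow
  have hpos := hσ.eigenvalues_pos
  set l := hσ.1.eigenvalues
  set U := hσ.1.eigenvectorUnitary
  have h1 : star (U : Mat N) * (U : Mat N) = 1 := Unitary.coe_star_mul_self U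
  have h2 : (U : Mat N) * star (U : Mat N) = 1 := Unitary.coe_mul_star_self U
  generalize (U : Mat N) = u at *
  obtain ⟨Y, rfl⟩ : ∃ Y, X = u * Y * star u := ⟨star u * X * u, by
    calc X = (u * star u) * X * (u * star u) := by rw [h2]; simp
      _ = _ := by simp only [Matrix.mul_assoc]⟩
  have e1 : ∀ D Y : Mat N, u * D * star u * (u * Y * star u) = u * (D * Y) * star u := by
    intro D Y
    calc _ = u * (D * (star u * u) * Y) * star u := by simp only [Matrix.mul_assoc]
      _ = _ := by rw [h1, Matrix.mul_one]
  have inj : ∀ D Y : Mat N, u * D * star u = u * Y * star u → D = Y := by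
    intro D Y h
    have e : ∀ D : Mat N, D = star u * (u * D * star u) * u := fun D => by
      calc D = (star u * u) * D * (star u * u) := by rw [h1]; simp
      _ = _ := by simp only [Matrix.mul_assoc]
    rw [e D, h, ← e]
  have e2 : ∀ (c : ℂ) (D : Mat N), c • (u * D * star u) = u * (c • D) * star u := by
    intro c D; simp
  rw [hs, e1, e1, e2] at h
  have h := inj _ _ h
  rw [e1, e1, e2]
  congr 2
  ext i k
  have hik := congrFun (congrFun h i) k
  simp only [Matrix.diagonal_mul, Matrix.smul_apply, Matrix.mul_diagonal, smul_eq_mul] at hik ⊢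
  by_cases hY : Y i k = 0
  · simp [hY]
  · have : ((l i : ℝ) : ℂ) = ((μ * l k : ℝ) : ℂ) := by
      apply mul_right_cancel₀ hY
      rw [hik]; push_cast; ring
    have := Complex.ofReal_injective this
    rw [this, Real.mul_rpow hμ.le (hpos k).le]
    push_cast; ring

lemma conj_comm (σ : Mat N) (hσ : σ.PosDef) (X : Mat N) (μ : ℝ) (hμ : 0 < μ)
    (h : σ * X = (μ : ℂ) • (X * σ)) : σ * Xᴴ = ((μ⁻¹ : ℝ) : ℂ) • (Xᴴ * σ) := by
  have := congrArg conjTranspose h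
  simp only [conjTranspose_mul, conjTranspose_smul, hσ.1.eq] at this
  rw [this, smul_smul]
  have : ((μ⁻¹ : ℝ) : ℂ) * star (μ : ℂ) = 1 := by
    simp [hμ.ne']
  rw [this, one_smul]

lemma ds_kr (σ : Mat N) (hσ : σ.PosDef) (s : ℝ) (X : Mat N) (μ : ℝ) (hμ : 0 < μ)
    (h : σ * X = (μ : ℂ) • (X * σ)) (A B : Mat N) :
    dsInner σ hσ s B (kr X A) = ((μ⁻¹ : ℝ) : ℂ) * dsInner σ hσ s (kr Xᴴ B) A := by
  have h1 := mpow_comm σ hσ s Xᴴ μ⁻¹ (inv_pos.2 hμ) (conj_comm σ hσ X μ hμ h)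
  have h2 : X * mpow σ hσ (1 - s) = ((μ⁻¹ ^ (1 - s) : ℝ) : ℂ) • (mpow σ hσ (1 - s) * X) := by
    rw [mpow_comm σ hσ (1 - s) X μ hμ h, smul_smul, ← Complex.ofReal_mul,
      ← Real.mul_rpow (inv_pos.2 hμ).le hμ.le, inv_mul_cancel₀ hμ.ne']
    simp
  unfold dsInner
  simp only [kr_apply, conjTranspose_mul, conjTranspose_conjTranspose]
  calc _ = (Bᴴ * (mpow σ hσ s * Xᴴ) * A * (X * mpow σ hσ (1 - s))).trace := by
        simp only [Matrix.mul_assoc]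
    _ = ((μ⁻¹ ^ (1 - s) : ℝ) : ℂ) * ((μ⁻¹ ^ s : ℝ) : ℂ) *
        ((Bᴴ * Xᴴ * mpow σ hσ s * A * mpow σ hσ (1 - s)) * X).trace := by
        rw [h1, h2]
        simp only [Matrix.mul_smul, Matrix.smul_mul, Matrix.trace_smul, smul_eq_mul,
          Matrix.mul_assoc]
        ring
    _ = _ := by
        rw [← Complex.ofReal_mul, ← Real.rpow_add (inv_pos.2 hμ), Matrix.trace_mul_comm]
        simp only [sub_add_cancel, Real.rpow_one, Matrix.mul_assoc]

lemma ds_add_right (σ : Mat N) (hσ : σ.PosDef) (s : ℝ) (B A A' : Mat N) :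
    dsInner σ hσ s B (A + A') = dsInner σ hσ s B A + dsInner σ hσ s B A' := by
  simp [dsInner, mul_add, add_mul]

lemma ds_add_left (σ : Mat N) (hσ : σ.PosDef) (s : ℝ) (B A A' : Mat N) :
    dsInner σ hσ s (A + A') B = dsInner σ hσ s A B + dsInner σ hσ s A' B := by
  simp [dsInner, add_mul]

lemma ds_smul_right (σ : Mat N) (hσ : σ.PosDef) (s : ℝ) (B A : Mat N) (c : ℂ) :
    dsInner σ hσ s B (c • A) = c * dsInner σ hσ s B A := by
  simp [dsInner]

lemma ds_smul_left (σ : Mat N) (hσ : σ.PosDef) (s : ℝ) (B A : Mat N) (c : ℝ) :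
    dsInner σ hσ s ((c : ℂ) • B) A = c * dsInner σ hσ s B A := by
  simp [dsInner]

lemma ds_sum_right {ι : Type*} (t : Finset ι) (σ : Mat N) (hσ : σ.PosDef) (s : ℝ) (B : Mat N)
    (A : ι → Mat N) : dsInner σ hσ s B (∑ i ∈ t, A i) = ∑ i ∈ t, dsInner σ hσ s B (A i) := by
  simp [dsInner, Finset.mul_sum, Finset.sum_mul, Matrix.trace_sum]

lemma ds_sum_left {ι : Type*} (t : Finset ι) (σ : Mat N) (hσ : σ.PosDef) (s : ℝ) (B : Mat N)
    (A : ι → Mat N) : dsInner σ hσ s (∑ i ∈ t, A i) B = ∑ i ∈ t, dsInner σ hσ s (A i) B := by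
  simp [dsInner, Finset.sum_mul, Matrix.trace_sum, Matrix.conjTranspose_sum]

lemma ds_nondeg (σ : Mat N) (hσ : σ.PosDef) (s : ℝ) (Z W : Mat N)
    (h : ∀ A, dsInner σ hσ s Z A = dsInner σ hσ s W A) : Z = W := by
  rw [← sub_eq_zero]
  have := h (mpow σ hσ (-s) * (Z - W) * mpow σ hσ (-(1 - s)))
  have e : ∀ B : Mat N, dsInner σ hσ s B (mpow σ hσ (-s) * (Z - W) * mpow σ hσ (-(1 - s)))
      = (Bᴴ * (Z - W)).trace := by
    intro B
    have h3 : mpow σ hσ (-(1 - s)) * mpow σ hσ (1 - s) = 1 := by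
      have := mpow_mul_neg σ hσ (-(1 - s))
      rwa [neg_neg] at this
    unfold dsInner
    calc _ = (Bᴴ * (mpow σ hσ s * mpow σ hσ (-s)) * (Z - W) *
          (mpow σ hσ (-(1 - s)) * mpow σ hσ (1 - s))).trace := by simp only [Matrix.mul_assoc]
      _ = _ := by rw [mpow_mul_neg, h3]; simp
  rw [e, e, ← sub_eq_zero, ← Matrix.trace_sub, ← Matrix.sub_mul, ← conjTranspose_sub] at this
  exact Matrix.trace_conjTranspose_mul_self_eq_zero_iff.1 this

lemma FormOne.sa {σ : Mat N} (hσ : σ.PosDef) (s : ℝ) {Φ : Mat N →ₗ[ℂ] Mat N}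
    (h : FormOne σ Φ) : IsDsSelfAdjoint σ hσ s Φ := by
  obtain ⟨V, ω, hω, hV, rfl⟩ := (formOne_iff σ hσ Φ).1 h
  intro A B
  have h1 := ds_kr σ hσ s V _ (Real.exp_pos ω) hV A B
  have h2 := ds_kr σ hσ s Vᴴ _ (inv_pos.2 (Real.exp_pos ω))
    (conj_comm σ hσ V _ (Real.exp_pos ω) hV) A B
  simp only [LinearMap.add_apply, LinearMap.smul_apply, ds_add_left, ds_add_right, ds_smul_right,
    ds_smul_left]
  rw [h1, h2, conjTranspose_conjTranspose, ← mul_assoc, ← mul_assoc, ← Complex.ofReal_mul,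
    ← Complex.ofReal_mul, inv_inv, ← Real.exp_neg, ← Real.exp_add, ← Real.exp_add, add_comm]
  ring_nf

lemma FormTwo.sa {σ : Mat N} (hσ : σ.PosDef) (s : ℝ) {Φ : Mat N →ₗ[ℂ] Mat N}
    (h : FormTwo σ Φ) : IsDsSelfAdjoint σ hσ s Φ := by
  obtain ⟨V, hV, hV', rfl⟩ := (formTwo_iff σ hσ Φ).1 h
  intro A B
  have h1 := ds_kr σ hσ s V 1 one_pos (by simpa using hV) A B
  simpa [hV'] using h1

lemma FormOne.cp {σ : Mat N} (hσ : σ.PosDef) {Φ : Mat N →ₗ[ℂ] Mat N}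
    (h : FormOne σ Φ) : IsCP Φ := by
  obtain ⟨V, ω, hω, hV, rfl⟩ := (formOne_iff σ hσ Φ).1 h
  exact ((IsCP.kr _).smul (Real.exp_pos _).le).add ((IsCP.kr _).smul (Real.exp_pos _).le)

lemma FormTwo.cp {σ : Mat N} (hσ : σ.PosDef) {Φ : Mat N →ₗ[ℂ] Mat N}
    (h : FormTwo σ Φ) : IsCP Φ := by
  obtain ⟨V, hV, hV', rfl⟩ := (formTwo_iff σ hσ Φ).1 h
  exact IsCP.kr _

/-! ### Block structure -/

lemma trace_diag (b a : Mat N) (d d' : Fin N → ℂ) :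
    (bᴴ * Matrix.diagonal d * a * Matrix.diagonal d').trace =
      ∑ p, ∑ q, star (b q p) * d q * a q p * d' p := by
  simp only [Matrix.trace, Matrix.diag_apply]
  refine Finset.sum_congr rfl fun p _ => ?_
  rw [Matrix.mul_diagonal, Matrix.mul_apply, Finset.sum_mul]
  refine Finset.sum_congr rfl fun q _ => ?_
  rw [Matrix.mul_diagonal, conjTranspose_apply]

lemma sum_single (f : Fin N → Fin N → ℂ) (k l : Fin N)
    (h : ∀ p q, ¬ (k = q ∧ l = p) → f p q = 0) : ∑ p, ∑ q, f p q = f l k := by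
  rw [Finset.sum_eq_single l, Finset.sum_eq_single k]
  · intro q _ hq; exact h _ _ (fun h => hq h.1.symm)
  · simp
  · intro p _ hp
    exact Finset.sum_eq_zero fun q _ => h _ _ (fun h => hp h.2.symm)
  · simp

lemma dsInner_conj (σ : Mat N) (hσ : σ.PosDef) (s : ℝ) (b a : Mat N) :
    dsInner σ hσ s
      ((hσ.1.eigenvectorUnitary : Mat N) * b * star (hσ.1.eigenvectorUnitary : Mat N))
      ((hσ.1.eigenvectorUnitary : Mat N) * a * star (hσ.1.eigenvectorUnitary : Mat N)) =
      ∑ p, ∑ q, star (b q p) * ((hσ.1.eigenvalues q ^ s : ℝ) : ℂ) * a q p *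
        ((hσ.1.eigenvalues p ^ (1 - s) : ℝ) : ℂ) := by
  rw [← trace_diag b a (fun q => ((hσ.1.eigenvalues q ^ s : ℝ) : ℂ))
    (fun p => ((hσ.1.eigenvalues p ^ (1 - s) : ℝ) : ℂ))]
  unfold dsInner mpow
  have h1 : star (hσ.1.eigenvectorUnitary : Mat N) * (hσ.1.eigenvectorUnitary : Mat N) = 1 :=
    Unitary.coe_star_mul_self _
  generalize (hσ.1.eigenvectorUnitary : Mat N) = u at *
  generalize Matrix.diagonal (fun q => ((hσ.1.eigenvalues q ^ s : ℝ) : ℂ)) = d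
  generalize Matrix.diagonal (fun q => ((hσ.1.eigenvalues q ^ (1 - s) : ℝ) : ℂ)) = d'
  rw [star_eq_conjTranspose] at *
  simp only [conjTranspose_mul, conjTranspose_conjTranspose]
  calc _ = (u * (bᴴ * (uᴴ * u) * d * (uᴴ * u) * a * (uᴴ * u) * d' * uᴴ)).trace := by
        simp only [Matrix.mul_assoc]
    _ = _ := by
        rw [Matrix.trace_mul_comm, h1]
        simp only [Matrix.mul_one]
        rw [Matrix.mul_assoc, h1, Matrix.mul_one]

/-- Choi-type coefficients of a Kraus family. -/
def choi {M : ℕ} (W : Fin M → Mat N) (i k j l : Fin N) : ℂ :=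
  ∑ a, star (W a i k) * W a j l

lemma kr_entry (W B : Mat N) (k l : Fin N) :
    kr W B k l = ∑ j, ∑ i, star (W i k) * B i j * W j l := by
  simp only [kr_apply, Matrix.mul_apply, conjTranspose_apply, Finset.sum_mul]

lemma kr_single {M : ℕ} (W : Fin M → Mat N) (i j k l : Fin N) :
    (∑ a, kr (W a) (Matrix.single i j 1)) k l = choi W i k j l := by
  rw [Matrix.sum_apply]
  refine Finset.sum_congr rfl fun a _ => ?_
  rw [kr_entry, sum_single _ i j]
  · simp
  · intro p q h
    simp [h]

lemma kr_conj (u W a : Mat N) (h1 : star u * u = 1) :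
    kr (u * W * star u) (u * a * star u) = u * kr W a * star u := by
  rw [star_eq_conjTranspose] at *
  simp only [kr_apply, conjTranspose_mul, conjTranspose_conjTranspose]
  calc _ = u * (Wᴴ * (uᴴ * u) * a * (uᴴ * u) * W) * uᴴ := by simp only [Matrix.mul_assoc]
    _ = _ := by rw [h1]; simp only [Matrix.mul_one]

lemma choi_eq (σ : Mat N) (hσ : σ.PosDef) (s : ℝ) {M : ℕ} (W : Fin M → Mat N)
    (hsa : IsDsSelfAdjoint σ hσ s (∑ a, kr ((hσ.1.eigenvectorUnitary : Mat N) * W a *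
      star (hσ.1.eigenvectorUnitary : Mat N)))) (i k j l : Fin N) :
    ((hσ.1.eigenvalues k ^ s * hσ.1.eigenvalues l ^ (1 - s) : ℝ) : ℂ) * choi W i k j l =
    ((hσ.1.eigenvalues i ^ s * hσ.1.eigenvalues j ^ (1 - s) : ℝ) : ℂ) * choi W l j k i := by
  have h1 : star (hσ.1.eigenvectorUnitary : Mat N) * (hσ.1.eigenvectorUnitary : Mat N) = 1 :=
    Unitary.coe_star_mul_self _
  have := hsa ((hσ.1.eigenvectorUnitary : Mat N) * Matrix.single i j 1 *
      star (hσ.1.eigenvectorUnitary : Mat N)) ((hσ.1.eigenvectorUnitary : Mat N) *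
      Matrix.single k l 1 * star (hσ.1.eigenvectorUnitary : Mat N))
  simp only [LinearMap.sum_apply, kr_conj _ _ _ h1] at this
  rw [← Finset.sum_mul, ← Finset.sum_mul, ← Finset.mul_sum, ← Finset.mul_sum, dsInner_conj,
    dsInner_conj, sum_single _ k l, sum_single _ i j, kr_single, kr_single] at this
  · simp only [Matrix.single_apply_same, star_one, one_mul, mul_one] at this
    have e : star (choi W k i l j) = choi W l j k i := by
      simp only [choi, star_sum, star_mul, star_star]
    rw [e] at this
    push_cast
    linear_combination this
  · intro p q h
    simp [h]
  · intro p q h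
    simp [h]

lemma choi_block (σ : Mat N) (hσ : σ.PosDef) (s : ℝ) (hs' : s ≠ 1/2) {M : ℕ} (W : Fin M → Mat N)
    (hsa : IsDsSelfAdjoint σ hσ s (∑ a, kr ((hσ.1.eigenvectorUnitary : Mat N) * W a *
      star (hσ.1.eigenvectorUnitary : Mat N)))) (i k j l : Fin N)
    (hne : hσ.1.eigenvalues i / hσ.1.eigenvalues k ≠ hσ.1.eigenvalues j / hσ.1.eigenvalues l) :
    choi W i k j l = 0 := by
  by_contra hC
  have e1 := choi_eq σ hσ s W hsa i k j l
  have e2 := choi_eq σ hσ s W hsa l j k i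
  have hpos := hσ.eigenvalues_pos
  generalize hσ.1.eigenvalues = x at *
  have hi := hpos i
  have hj := hpos j
  have hk := hpos k
  have hl := hpos l
  have e3 : (((x k ^ s * x l ^ (1 - s)) * (x j ^ s * x i ^ (1 - s)) : ℝ) : ℂ) =
      (((x i ^ s * x j ^ (1 - s)) * (x l ^ s * x k ^ (1 - s)) : ℝ) : ℂ) := by
    apply mul_right_cancel₀ hC
    push_cast at e1 e2 ⊢
    linear_combination ((x j ^ s : ℝ) : ℂ) * ((x i ^ (1 - s) : ℝ) : ℂ) * e1 +
      ((x i ^ s : ℝ) : ℂ) * ((x j ^ (1 - s) : ℝ) : ℂ) * e2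
  have e3 := Complex.ofReal_injective e3
  have e4 : (x k * x j) ^ s * (x i * x l) ^ (1 - s) = (x i * x l) ^ s * (x k * x j) ^ (1 - s) := by
    rw [Real.mul_rpow hk.le hj.le, Real.mul_rpow hi.le hl.le, Real.mul_rpow hk.le hj.le,
      Real.mul_rpow hi.le hl.le]
    linear_combination e3
  have hp : 0 < x k * x j := mul_pos hk hj
  have hq : 0 < x i * x l := mul_pos hi hl
  have e5 := congrArg Real.log e4
  rw [Real.log_mul (Real.rpow_pos_of_pos hp _).ne' (Real.rpow_pos_of_pos hq _).ne',
    Real.log_mul (Real.rpow_pos_of_pos hq _).ne' (Real.rpow_pos_of_pos hp _).ne',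
    Real.log_rpow hp, Real.log_rpow hq, Real.log_rpow hp, Real.log_rpow hq] at e5
  have e6 : (2 * s - 1) * (Real.log (x k * x j) - Real.log (x i * x l)) = 0 := by
    linear_combination e5
  rcases mul_eq_zero.1 e6 with h | h
  · exact hs' (by linarith)
  · have := Real.log_injOn_pos hp hq (sub_eq_zero.1 h)
    apply hne
    rw [div_eq_div_iff hk.ne' hl.ne']
    linarith

/-- Part of `W` in the block of ratio `μ`. -/
def mask (x : Fin N → ℝ) (μ : ℝ) (W : Mat N) : Mat N :=
  fun i k => if x i / x k = μ then W i k else 0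

/-- the finite set of ratios -/
def ratios (x : Fin N → ℝ) : Finset ℝ :=
  Finset.univ.image fun p : Fin N × Fin N => x p.1 / x p.2

lemma sum_mask (x : Fin N → ℝ) {M : ℕ} (W : Fin M → Mat N)
    (h : ∀ i k j l, x i / x k ≠ x j / x l → choi W i k j l = 0) :
    ∑ μ ∈ ratios x, ∑ a, kr (mask x μ (W a)) = ∑ a, kr (W a) := by
  refine LinearMap.ext fun B => ?_
  ext k l
  simp only [LinearMap.sum_apply, Matrix.sum_apply, kr_entry]
  have e1 : ∀ V : Fin M → Mat N, ∑ a, ∑ j, ∑ i, star (V a i k) * B i j * V a j l =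
      ∑ j, ∑ i, B i j * choi V i k j l := by
    intro V
    rw [Finset.sum_comm]
    refine Finset.sum_congr rfl fun j _ => ?_
    rw [Finset.sum_comm]
    refine Finset.sum_congr rfl fun i _ => ?_
    rw [choi, Finset.mul_sum]
    exact Finset.sum_congr rfl fun a _ => by ring
  rw [e1]
  simp only [fun μ => e1 (fun a => mask x μ (W a))]
  rw [Finset.sum_comm]
  refine Finset.sum_congr rfl fun j _ => ?_
  rw [Finset.sum_comm]
  refine Finset.sum_congr rfl fun i _ => ?_
  rw [← Finset.mul_sum]
  congr 1
  have e2 : ∀ μ, choi (fun a => mask x μ (W a)) i k j l =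
      if x i / x k = μ then choi W i k j l else 0 := by
    intro μ
    unfold choi mask
    by_cases h1 : x i / x k = μ
    · by_cases h2 : x j / x l = μ
      · simp [h1, h2]
      · have := h i k j l (by rw [h1]; exact Ne.symm h2)
        unfold choi at this
        simp only [h1, h2, if_true, if_false, mul_zero, Finset.sum_const_zero]
        exact this.symm
    · simp [h1]
  simp only [e2]
  rw [Finset.sum_ite_eq, if_pos]
  exact Finset.mem_image.2 ⟨(i, k), Finset.mem_univ _, rfl⟩

lemma mask_comm (σ : Mat N) (hσ : σ.PosDef) (μ : ℝ) (W : Mat N) :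
    σ * ((hσ.1.eigenvectorUnitary : Mat N) * mask hσ.1.eigenvalues μ W *
      star (hσ.1.eigenvectorUnitary : Mat N)) =
    (μ : ℂ) • (((hσ.1.eigenvectorUnitary : Mat N) * mask hσ.1.eigenvalues μ W *
      star (hσ.1.eigenvectorUnitary : Mat N)) * σ) := by
  have hs := spec σ hσ
  have h1 : star (hσ.1.eigenvectorUnitary : Mat N) * (hσ.1.eigenvectorUnitary : Mat N) = 1 :=
    Unitary.coe_star_mul_self _
  have hpos := hσ.eigenvalues_pos
  generalize (hσ.1.eigenvectorUnitary : Mat N) = u at *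
  generalize hσ.1.eigenvalues = x at *
  rw [hs]
  have e1 : ∀ D Y : Mat N, u * D * star u * (u * Y * star u) = u * (D * Y) * star u := by
    intro D Y
    calc _ = u * (D * (star u * u) * Y) * star u := by simp only [Matrix.mul_assoc]
      _ = _ := by rw [h1, Matrix.mul_one]
  rw [e1, e1, ← Matrix.smul_mul, ← Matrix.mul_smul]
  congr 2
  ext i k
  simp only [Matrix.diagonal_mul, Matrix.smul_apply, Matrix.mul_diagonal, smul_eq_mul, mask]
  split_ifs with h
  · have : x i = μ * x k := by rw [← h, div_mul_cancel₀ _ (hpos k).ne']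
    rw [this]; push_cast; ring
  · simp

/-- A cone element has a Kraus family made of eigenoperators of the modular operator. -/
lemma eigen_kraus (σ : Mat N) (hσ : σ.PosDef) (s : ℝ) (hs' : s ≠ 1/2)
    (Φ : Mat N →ₗ[ℂ] Mat N) (hcp : IsCP Φ) (hsa : IsDsSelfAdjoint σ hσ s Φ) :
    ∃ (T : Finset ℝ) (M : ℕ) (X : ℝ → Fin M → Mat N), (∀ μ ∈ T, 0 < μ) ∧
      (∀ μ a, σ * X μ a = (μ : ℂ) • (X μ a * σ)) ∧ Φ = ∑ μ ∈ T, ∑ a, kr (X μ a) := by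
  obtain ⟨M, V, rfl⟩ := (isCP_iff Φ).1 hcp
  have h1 : star (hσ.1.eigenvectorUnitary : Mat N) * (hσ.1.eigenvectorUnitary : Mat N) = 1 :=
    Unitary.coe_star_mul_self _
  have h2 : (hσ.1.eigenvectorUnitary : Mat N) * star (hσ.1.eigenvectorUnitary : Mat N) = 1 :=
    Unitary.coe_mul_star_self _
  obtain ⟨W, rfl⟩ : ∃ W : Fin M → Mat N, V = fun a => (hσ.1.eigenvectorUnitary : Mat N) * W a *
      star (hσ.1.eigenvectorUnitary : Mat N) := by
    refine ⟨fun a => star (hσ.1.eigenvectorUnitary : Mat N) * V a *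
      (hσ.1.eigenvectorUnitary : Mat N), ?_⟩
    funext a
    generalize (hσ.1.eigenvectorUnitary : Mat N) = u at *
    calc V a = (u * star u) * V a * (u * star u) := by rw [h2]; simp
      _ = _ := by simp only [Matrix.mul_assoc]
  refine ⟨ratios hσ.1.eigenvalues, M, fun μ a => (hσ.1.eigenvectorUnitary : Mat N) *
    mask hσ.1.eigenvalues μ (W a) * star (hσ.1.eigenvectorUnitary : Mat N), ?_, ?_, ?_⟩
  · intro μ hμ
    obtain ⟨p, _, rfl⟩ := Finset.mem_image.1 hμ
    exact div_pos (hσ.eigenvalues_pos _) (hσ.eigenvalues_pos _)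
  · exact fun μ a => mask_comm σ hσ μ (W a)
  · have := sum_mask _ W (choi_block σ hσ s hs' W hsa)
    generalize (hσ.1.eigenvectorUnitary : Mat N) = u at *
    refine LinearMap.ext fun A => ?_
    obtain ⟨B, rfl⟩ : ∃ B, A = u * B * star u := ⟨star u * A * u, by
      calc A = (u * star u) * A * (u * star u) := by rw [h2]; simp
        _ = _ := by simp only [Matrix.mul_assoc]⟩
    have := LinearMap.congr_fun this B
    simp only [LinearMap.sum_apply, kr_conj _ _ _ h1] at this ⊢
    simp only [← Finset.sum_mul, ← Finset.mul_sum]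
    rw [this]

/-- Sum of nonnegative multiples of maps of the two forms. -/
inductive Dec (σ : Mat N) : (Mat N →ₗ[ℂ] Mat N) → Prop
  | zero : Dec σ 0
  | cons (c : ℝ) (F Φ : Mat N →ₗ[ℂ] Mat N) (hc : 0 ≤ c) (hF : FormOne σ F ∨ FormTwo σ F)
      (h : Dec σ Φ) : Dec σ ((c : ℂ) • F + Φ)

lemma Dec.add {σ : Mat N} {Φ Ψ : Mat N →ₗ[ℂ] Mat N} (h : Dec σ Φ) (h' : Dec σ Ψ) :
    Dec σ (Φ + Ψ) := by
  induction h with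
  | zero => simpa using h'
  | cons c F Φ hc hF h ih => rw [add_assoc]; exact Dec.cons c F _ hc hF ih

lemma Dec.form {σ : Mat N} {F : Mat N →ₗ[ℂ] Mat N} (c : ℝ) (hc : 0 ≤ c)
    (hF : FormOne σ F ∨ FormTwo σ F) : Dec σ ((c : ℂ) • F) := by
  simpa using Dec.cons c F 0 hc hF Dec.zero

lemma Dec.sum {ι : Type*} {σ : Mat N} (t : Finset ι) (f : ι → Mat N →ₗ[ℂ] Mat N)
    (h : ∀ i ∈ t, Dec σ (f i)) : Dec σ (∑ i ∈ t, f i) := by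
  classical
  induction t using Finset.induction_on with
  | empty => simpa using Dec.zero
  | insert a t ha ih =>
    rw [Finset.sum_insert ha]
    exact (h a (by simp)).add (ih fun i hi => h i (by simp [hi]))

lemma Dec.exists {σ : Mat N} {Φ : Mat N →ₗ[ℂ] Mat N} (h : Dec σ Φ) :
    ∃ (n : ℕ) (c : Fin n → ℝ) (F : Fin n → (Mat N →ₗ[ℂ] Mat N)),
        (∀ i, 0 ≤ c i) ∧ (∀ i, FormOne σ (F i) ∨ FormTwo σ (F i)) ∧
        Φ = ∑ i, (c i : ℂ) • F i := by
  induction h with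
  | zero => exact ⟨0, Fin.elim0, Fin.elim0, fun i => i.elim0, fun i => i.elim0, by simp⟩
  | cons c F Φ hc hF h ih =>
    obtain ⟨n, d, G, hd, hG, rfl⟩ := ih
    refine ⟨n + 1, Fin.cons c d, Fin.cons F G, ?_, ?_, ?_⟩
    · intro i; refine Fin.cases ?_ ?_ i <;> simp [hc, hd]
    · intro i; refine Fin.cases ?_ ?_ i <;> simp [hF, hG]
    · simp [Fin.sum_univ_succ]

lemma dec_term_gt (σ : Mat N) (hσ : σ.PosDef) (X : Mat N) (μ : ℝ) (hμ : 1 < μ)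
    (h : σ * X = (μ : ℂ) • (X * σ)) (c : ℝ) (hc : 0 ≤ c) :
    Dec σ ((c : ℂ) • (kr X + ((μ⁻¹ : ℝ) : ℂ) • kr Xᴴ)) := by
  have hμ0 : 0 < μ := by linarith
  have hF : FormOne σ ((Real.exp (Real.log μ / 2) : ℂ) • kr X +
      (Real.exp (-(Real.log μ / 2)) : ℂ) • kr Xᴴ) := by
    refine (formOne_iff σ hσ _).2 ⟨X, Real.log μ, Real.log_pos hμ, ?_, by norm_cast⟩
    rw [Real.exp_log hμ0]; exact h
  have := Dec.form (σ := σ) (c * Real.exp (-(Real.log μ / 2)))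
    (mul_nonneg hc (Real.exp_pos _).le) (Or.inl hF)
  convert this using 1
  simp only [smul_add, smul_smul]
  have e1 : c * Real.exp (-(Real.log μ / 2)) * Real.exp (Real.log μ / 2) = c := by
    rw [mul_assoc, ← Real.exp_add]; simp
  have e2 : c * Real.exp (-(Real.log μ / 2)) * Real.exp (-(Real.log μ / 2)) = c * μ⁻¹ := by
    rw [mul_assoc, ← Real.exp_add, ← neg_add, add_halves, Real.exp_neg, Real.exp_log hμ0]
  rw [← Complex.ofReal_mul, ← Complex.ofReal_mul,
    ← Complex.ofReal_mul, e1, e2]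

lemma dec_term (σ : Mat N) (hσ : σ.PosDef) (X : Mat N) (μ : ℝ) (hμ : 0 < μ)
    (h : σ * X = (μ : ℂ) • (X * σ)) :
    Dec σ (((1 / 2 : ℝ) : ℂ) • (kr X + ((μ⁻¹ : ℝ) : ℂ) • kr Xᴴ)) := by
  rcases lt_trichotomy μ 1 with h1 | h1 | h1
  · have := dec_term_gt σ hσ Xᴴ μ⁻¹ ((one_lt_inv₀ hμ).2 h1) (conj_comm σ hσ X μ hμ h)
      ((1 / 2) * μ⁻¹) (by positivity)
    convert this using 1
    rw [conjTranspose_conjTranspose, inv_inv, smul_add, smul_add, smul_smul, smul_smul,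
      ← Complex.ofReal_mul, ← Complex.ofReal_mul, mul_assoc, inv_mul_cancel₀ hμ.ne', mul_one,
      add_comm]
  · subst h1
    have hX : σ * X = X * σ := by simpa using h
    have hX' : σ * Xᴴ = Xᴴ * σ := by simpa using conj_comm σ hσ X 1 one_pos h
    set Y : Mat N := (1 / 2 : ℂ) • (X + Xᴴ) with hY
    set Z : Mat N := (Complex.I / 2) • (X - Xᴴ) with hZ
    have hYF : FormTwo σ (kr Y) := by
      refine (formTwo_iff σ hσ _).2 ⟨Y, ?_, ?_, rfl⟩
      · simp [hY, mul_add, add_mul, hX, hX']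
      · rw [hY, conjTranspose_smul, conjTranspose_add, conjTranspose_conjTranspose, add_comm]
        simp
    have hZF : FormTwo σ (kr Z) := by
      refine (formTwo_iff σ hσ _).2 ⟨Z, ?_, ?_, rfl⟩
      · simp [hZ, mul_sub, sub_mul, hX, hX']
      · rw [hZ, conjTranspose_smul, conjTranspose_sub, conjTranspose_conjTranspose,
          ← neg_sub X, smul_neg, ← neg_smul]
        congr 1
        simp [neg_div]
    have := (Dec.form 1 zero_le_one (Or.inr hYF)).add (Dec.form 1 zero_le_one (Or.inr hZF))
    convert this using 1
    have hYs : Yᴴ = Y := by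
      rw [hY, conjTranspose_smul, conjTranspose_add, conjTranspose_conjTranspose, add_comm]
      simp
    have hZs : Zᴴ = Z := by
      rw [hZ, conjTranspose_smul, conjTranspose_sub, conjTranspose_conjTranspose,
          ← neg_sub X, smul_neg, ← neg_smul]
      congr 1
      simp [neg_div]
    refine LinearMap.ext fun A => ?_
    simp only [LinearMap.add_apply, LinearMap.smul_apply, kr_apply, hYs, hZs,
      conjTranspose_conjTranspose]
    rw [hY, hZ]
    simp only [Matrix.smul_mul, Matrix.mul_smul, mul_add, add_mul, mul_sub, sub_mul, smul_smul,
      smul_add, smul_sub]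
    have hI : Complex.I / 2 * (Complex.I / 2) = -(1 / 4) := by
      linear_combination (1 / 4 : ℂ) * Complex.I_mul_I
    simp only [hI]
    push_cast
    module
  · exact dec_term_gt σ hσ X μ h1 h (1 / 2) (by norm_num)

lemma dec_main (σ : Mat N) (hσ : σ.PosDef) (s : ℝ) (hs' : s ≠ 1/2)
    (Φ : Mat N →ₗ[ℂ] Mat N) (hcp : IsCP Φ) (hsa : IsDsSelfAdjoint σ hσ s Φ) : Dec σ Φ := by
  obtain ⟨T, M, X, hT, hX, hΦ⟩ := eigen_kraus σ hσ s hs' Φ hcp hsa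
  have hadj : Φ = ∑ μ ∈ T, ∑ a, ((μ⁻¹ : ℝ) : ℂ) • kr (X μ a)ᴴ := by
    refine LinearMap.ext fun B => ds_nondeg σ hσ s _ _ fun A => ?_
    rw [← hsa A B, hΦ]
    simp only [LinearMap.sum_apply, ds_sum_left, ds_sum_right, LinearMap.smul_apply, ds_smul_left]
    refine Finset.sum_congr rfl fun μ hμ => Finset.sum_congr rfl fun a _ => ?_
    exact ds_kr σ hσ s _ μ (hT μ hμ) (hX μ a) A B
  have : Φ = ∑ μ ∈ T, ∑ a, ((1 / 2 : ℝ) : ℂ) • (kr (X μ a) + ((μ⁻¹ : ℝ) : ℂ) • kr (X μ a)ᴴ) := by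
    simp only [← Finset.smul_sum, Finset.sum_add_distrib]
    simp only [← Finset.smul_sum] at hadj
    rw [← hadj, ← hΦ]
    push_cast
    module
  rw [this]
  exact Dec.sum _ _ fun μ hμ => Dec.sum _ _ fun a _ => dec_term σ hσ _ μ (hT μ hμ) (hX μ a)

/-! ### Extremality -/

/-- Quadratic form of the Choi matrix of `Φ` at the functional `f`. -/
def qf (f : Mat N →ₗ[ℂ] ℂ) (Φ : Mat N →ₗ[ℂ] Mat N) : ℂ :=
  ∑ i, ∑ k, ∑ j, ∑ l, star (f (Matrix.single i k 1)) * f (Matrix.single j l 1) *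
    Φ (Matrix.single i j 1) k l

lemma qf_add (f : Mat N →ₗ[ℂ] ℂ) (Φ Ψ : Mat N →ₗ[ℂ] Mat N) :
    qf f (Φ + Ψ) = qf f Φ + qf f Ψ := by
  simp [qf, mul_add, Finset.sum_add_distrib]

lemma qf_smul (f : Mat N →ₗ[ℂ] ℂ) (c : ℂ) (Φ : Mat N →ₗ[ℂ] Mat N) :
    qf f (c • Φ) = c * qf f Φ := by
  simp only [qf, Finset.mul_sum, LinearMap.smul_apply, Matrix.smul_apply, smul_eq_mul]
  refine Finset.sum_congr rfl fun i _ => Finset.sum_congr rfl fun k _ =>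
    Finset.sum_congr rfl fun j _ => Finset.sum_congr rfl fun l _ => by ring

lemma fun_expand (f : Mat N →ₗ[ℂ] ℂ) (K : Mat N) :
    f K = ∑ i, ∑ k, K i k * f (Matrix.single i k 1) := by
  conv_lhs => rw [Matrix.matrix_eq_sum_single K]
  simp only [map_sum]
  refine Finset.sum_congr rfl fun i _ => Finset.sum_congr rfl fun k _ => ?_
  have : Matrix.single i k (K i k) = K i k • Matrix.single i k (1 : ℂ) := by
    simp [Matrix.smul_single]
  rw [this, map_smul, smul_eq_mul]

lemma qf_kr (f : Mat N →ₗ[ℂ] ℂ) (K : Mat N) : qf f (kr K) = ((‖f K‖ ^ 2 : ℝ) : ℂ) := by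
  have e : ((‖f K‖ ^ 2 : ℝ) : ℂ) = star (f K) * f K := by
    rw [← Complex.normSq_eq_norm_sq, Complex.normSq_eq_conj_mul_self]; rfl
  rw [e, fun_expand f K]
  simp only [star_sum, Finset.sum_mul]
  unfold qf
  refine Finset.sum_congr rfl fun i _ => Finset.sum_congr rfl fun k _ => ?_
  simp only [Finset.mul_sum]
  refine Finset.sum_congr rfl fun j _ => Finset.sum_congr rfl fun l _ => ?_
  have : kr K (Matrix.single i j 1) k l = star (K i k) * K j l := by
    rw [kr_entry, sum_single _ i j]
    · simp
    · intro p q h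
      simp [h]
  rw [this, star_mul]
  ring

lemma qf_nonneg (f : Mat N →ₗ[ℂ] ℂ) (Φ : Mat N →ₗ[ℂ] Mat N) (h : IsCP Φ) :
    ∃ r : ℝ, 0 ≤ r ∧ qf f Φ = r := by
  obtain ⟨M, V, rfl⟩ := (isCP_iff Φ).1 h
  refine ⟨∑ j, ‖f (V j)‖ ^ 2, by positivity, ?_⟩
  have : ∀ t : Finset (Fin M), qf f (∑ j ∈ t, kr (V j)) = ∑ j ∈ t, qf f (kr (V j)) := by
    intro t
    classical
    induction t using Finset.induction_on with
    | empty => simp [qf]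
    | insert a t ha ih => rw [Finset.sum_insert ha, Finset.sum_insert ha, qf_add, ih]
  rw [this]
  simp [qf_kr]

lemma span_of_le (K₁ K₂ G : Mat N) (α β : ℂ) (c : ℝ) (hc : 0 < c)
    (h : IsCP (α • kr K₁ + β • kr K₂ - (c : ℂ) • kr G)) :
    ∃ a b : ℂ, G = a • K₁ + b • K₂ := by
  suffices hG : G ∈ Submodule.span ℂ {K₁, K₂} by
    obtain ⟨a, b, hab⟩ := Submodule.mem_span_pair.1 hG
    exact ⟨a, b, hab.symm⟩
  by_contra hG
  obtain ⟨f, hf, hle⟩ := Submodule.exists_le_ker_of_notMem hG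
  have h1 : f K₁ = 0 := hle (Submodule.subset_span (by simp))
  have h2 : f K₂ = 0 := hle (Submodule.subset_span (by simp))
  obtain ⟨r, hr, hq⟩ := qf_nonneg f _ h
  have e : qf f (α • kr K₁ + β • kr K₂ - (c : ℂ) • kr G) + c * qf f (kr G) = 0 := by
    rw [← qf_smul, ← qf_add, sub_add_cancel, qf_add, qf_smul, qf_smul, qf_kr, qf_kr, h1, h2]
    simp
  rw [hq, qf_kr, ← Complex.ofReal_mul, ← Complex.ofReal_add] at e
  have e' : r + c * ‖f G‖ ^ 2 = 0 := by exact_mod_cast e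
  have : 0 < ‖f G‖ := norm_pos_iff.2 hf
  have : 0 < c * ‖f G‖ ^ 2 := by positivity
  linarith

lemma eigen_unique (σ : Mat N) (hσ : σ.PosDef) (X : Mat N) (μ ν : ℂ) (hne : μ ≠ ν)
    (h1 : σ * X = μ • (X * σ)) (h2 : σ * X = ν • (X * σ)) : X = 0 := by
  have hu : IsUnit σ.det := (Matrix.isUnit_iff_isUnit_det _).1 hσ.isUnit
  have h : (μ - ν) • (X * σ) = 0 := by rw [sub_smul, ← h1, ← h2, sub_self]
  have h3 : X * σ = 0 := (smul_eq_zero.1 h).resolve_left (sub_ne_zero.2 hne)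
  calc X = X * σ * σ⁻¹ := by rw [Matrix.mul_assoc, Matrix.mul_nonsing_inv _ hu, Matrix.mul_one]
    _ = 0 := by rw [h3, Matrix.zero_mul]

lemma eigen_drop (σ : Mat N) (hσ : σ.PosDef) (X Y : Mat N) (μ μ' ν : ℂ) (h1 : μ' ≠ ν)
    (h2 : μ ≠ μ') (hX : σ * X = μ • (X * σ)) (hY : σ * Y = μ' • (Y * σ))
    (hs : σ * (X + Y) = ν • ((X + Y) * σ)) : Y = 0 := by
  have hu : IsUnit σ.det := (Matrix.isUnit_iff_isUnit_det _).1 hσ.isUnit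
  have e : ((μ - ν) • X + (μ' - ν) • Y) * σ = 0 := by
    rw [mul_add, add_mul, hX, hY, smul_add] at hs
    have e0 : ((μ - ν) • X + (μ' - ν) • Y) * σ = (μ • (X * σ) + μ' • (Y * σ)) -
        (ν • (X * σ) + ν • (Y * σ)) := by
      rw [Matrix.add_mul, Matrix.smul_mul, Matrix.smul_mul]
      module
    rw [e0, hs, sub_self]
  have e2 : (μ - ν) • X + (μ' - ν) • Y = 0 := by
    calc _ = ((μ - ν) • X + (μ' - ν) • Y) * σ * σ⁻¹ := by
          rw [Matrix.mul_assoc, Matrix.mul_nonsing_inv _ hu, Matrix.mul_one]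
      _ = 0 := by rw [e, Matrix.zero_mul]
  have e3 : (μ' - ν) • Y = (-(μ - ν)) • X := by
    rw [neg_smul]; exact eq_neg_of_add_eq_zero_right e2
  have e4 : (μ' - ν) • Y = 0 := by
    apply eigen_unique σ hσ _ μ μ' h2
    · rw [e3, Matrix.mul_smul, hX, Matrix.smul_mul, smul_comm]
    · rw [Matrix.mul_smul, hY, Matrix.smul_mul, smul_comm]
  exact (smul_eq_zero.1 e4).resolve_left (sub_ne_zero.2 h1)

lemma form_le (σ : Mat N) (hσ : σ.PosDef) (Φ F : Mat N →ₗ[ℂ] Mat N)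
    (hΦ : FormOne σ Φ ∨ FormTwo σ Φ) (hF : FormOne σ F ∨ FormTwo σ F) (r : ℝ) (hr : 0 < r)
    (h : IsCP (Φ - (r : ℂ) • F)) : ∃ d : ℝ, 0 ≤ d ∧ F = (d : ℂ) • Φ := by
  -- extract a Kraus operator of `F`
  have key : ∃ (G : Mat N) (ν c : ℝ), 1 ≤ ν ∧ 0 < c ∧ σ * G = (ν : ℂ) • (G * σ) ∧
      IsCP (Φ - (c : ℂ) • kr G) ∧ (ν = 1 → F = kr G) ∧
      F = (if ν = 1 then kr G else (Real.exp (Real.log ν / 2) : ℂ) • kr G +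
        (Real.exp (-(Real.log ν / 2)) : ℂ) • kr Gᴴ) := by
    rcases hF with hF | hF
    · obtain ⟨G, ω, hω, hG, rfl⟩ := (formOne_iff σ hσ F).1 hF
      refine ⟨G, Real.exp ω, r * Real.exp (ω / 2), Real.one_le_exp hω.le, by positivity, hG, ?_,
        ?_, ?_⟩
      · have := h.add ((IsCP.kr Gᴴ).smul (c := r * Real.exp (-(ω / 2))) (by positivity))
        convert this using 1
        rw [Complex.ofReal_mul, Complex.ofReal_mul]
        module
      · intro h1
        rw [Real.exp_eq_one_iff] at h1
        exact absurd h1 hω.ne'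
      · rw [if_neg, Real.log_exp]
        rw [Real.exp_eq_one_iff]; exact hω.ne'
    · obtain ⟨G, hG, hG', rfl⟩ := (formTwo_iff σ hσ F).1 hF
      exact ⟨G, 1, r, le_rfl, hr, by simpa using hG, h, fun _ => rfl, by simp⟩
  obtain ⟨G, ν, c, hν, hc, hG, hle, -, hFG⟩ := key
  have zero_case : G = 0 → ∃ d : ℝ, 0 ≤ d ∧ F = (d : ℂ) • Φ := by
    rintro rfl
    refine ⟨0, le_rfl, ?_⟩
    rw [hFG]
    split_ifs <;> simp [kr_zero]
  rcases hΦ with hΦ | hΦ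
  · obtain ⟨V, ω, hω, hV, rfl⟩ := (formOne_iff σ hσ Φ).1 hΦ
    have hV' := conj_comm σ hσ V _ (Real.exp_pos ω) hV
    obtain ⟨a, b, rfl⟩ := span_of_le _ _ _ _ _ c hc hle
    have h1 : 1 < Real.exp ω := Real.one_lt_exp_iff.2 hω
    have h2 : (Real.exp ω)⁻¹ < 1 := inv_lt_one_of_one_lt₀ h1
    have hb : b • Vᴴ = 0 := by
      refine eigen_drop σ hσ (a • V) (b • Vᴴ) (Real.exp ω : ℝ) ((Real.exp ω)⁻¹ : ℝ) (ν : ℝ)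
        ?_ ?_ ?_ ?_ hG
      · intro h; have := Complex.ofReal_injective h; linarith
      · intro h; have := Complex.ofReal_injective h; linarith
      · rw [Matrix.mul_smul, hV, Matrix.smul_mul, smul_comm]
      · rw [Matrix.mul_smul, hV', Matrix.smul_mul, smul_comm]
    rw [hb, add_zero] at hG hFG zero_case
    by_cases hνω : ν = Real.exp ω
    · refine ⟨‖a‖ ^ 2, by positivity, ?_⟩
      rw [hFG, if_neg (by rw [hνω]; exact h1.ne'), hνω, Real.log_exp, conjTranspose_smul, kr_smul,
        kr_smul, norm_star]
      module
    · apply zero_case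
      refine eigen_unique σ hσ _ (Real.exp ω : ℝ) (ν : ℝ) ?_ ?_ hG
      · intro h; exact hνω (Complex.ofReal_injective h).symm
      · rw [Matrix.mul_smul, hV, Matrix.smul_mul, smul_comm]
  · obtain ⟨V, hV, hV', rfl⟩ := (formTwo_iff σ hσ Φ).1 hΦ
    obtain ⟨a, b, hab⟩ := span_of_le V 0 G 1 0 c hc (by simpa using hle)
    rw [smul_zero, add_zero] at hab
    subst hab
    by_cases hν1 : ν = 1
    · refine ⟨‖a‖ ^ 2, by positivity, ?_⟩
      rw [hFG, if_pos hν1, kr_smul]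
    · apply zero_case
      refine eigen_unique σ hσ _ 1 (ν : ℝ) ?_ ?_ hG
      · intro h; exact hν1 (by exact_mod_cast h.symm)
      · rw [Matrix.mul_smul, hV, Matrix.smul_mul, one_smul]

lemma form_cp {σ : Mat N} (hσ : σ.PosDef) {F : Mat N →ₗ[ℂ] Mat N}
    (h : FormOne σ F ∨ FormTwo σ F) : IsCP F := h.elim (·.cp hσ) (·.cp hσ)

lemma form_sa {σ : Mat N} (hσ : σ.PosDef) (s : ℝ) {F : Mat N →ₗ[ℂ] Mat N}
    (h : FormOne σ F ∨ FormTwo σ F) : IsDsSelfAdjoint σ hσ s F := h.elim (·.sa hσ s) (·.sa hσ s)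

lemma Dec.cp {σ : Mat N} (hσ : σ.PosDef) {Φ : Mat N →ₗ[ℂ] Mat N} (h : Dec σ Φ) : IsCP Φ := by
  induction h with
  | zero => exact IsCP.zero
  | cons c F Φ hc hF h ih => exact ((form_cp hσ hF).smul hc).add ih

lemma form_extremal (σ : Mat N) (hσ : σ.PosDef) (Φ Ψ : Mat N →ₗ[ℂ] Mat N)
    (hΦ : FormOne σ Φ ∨ FormTwo σ Φ) (hΨ : Dec σ Ψ) (t : ℝ) (ht : 0 < t)
    (h : IsCP (Φ - (t : ℂ) • Ψ)) : ∃ d : ℝ, 0 ≤ d ∧ Ψ = (d : ℂ) • Φ := by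
  induction hΨ with
  | zero => exact ⟨0, le_rfl, by simp⟩
  | cons c F Ψ hc hF hD ih =>
    obtain ⟨d, hd, hd'⟩ := ih (by
      have := h.add ((form_cp hσ hF).smul (c := t * c) (by positivity))
      convert this using 1
      rw [Complex.ofReal_mul]; module)
    rcases hc.eq_or_lt with hc0 | hc0
    · refine ⟨d, hd, ?_⟩
      rw [← hc0, ← hd']; simp
    · obtain ⟨e, he, he'⟩ := form_le σ hσ Φ F hΦ hF (t * c) (by positivity) (by
        have := h.add ((hD.cp hσ).smul ht.le)
        convert this using 1
        rw [Complex.ofReal_mul]; module)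
      refine ⟨c * e + d, by positivity, ?_⟩
      rw [hd', he']
      push_cast
      module

lemma Dec.exists_le {σ : Mat N} (hσ : σ.PosDef) {Φ : Mat N →ₗ[ℂ] Mat N} (h : Dec σ Φ)
    (h0 : Φ ≠ 0) : ∃ (c : ℝ) (F : Mat N →ₗ[ℂ] Mat N), 0 < c ∧ F ≠ 0 ∧
      (FormOne σ F ∨ FormTwo σ F) ∧ IsCP (Φ - (c : ℂ) • F) := by
  induction h with
  | zero => exact absurd rfl h0
  | cons c F Φ hc hF hD ih =>
    by_cases hcF : (c : ℂ) • F = 0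
    · rw [hcF, zero_add] at h0 ⊢
      exact ih h0
    · rw [smul_eq_zero, not_or] at hcF
      refine ⟨c, F, lt_of_le_of_ne hc ?_, hcF.2, hF, ?_⟩
      · intro h; exact hcF.1 (by rw [← h]; simp)
      · rw [add_sub_cancel_left]; exact hD.cp hσ

lemma form_smul (σ : Mat N) (hσ : σ.PosDef) (F : Mat N →ₗ[ℂ] Mat N)
    (hF : FormOne σ F ∨ FormTwo σ F) (r : ℝ) (hr : 0 ≤ r) :
    FormOne σ ((r : ℂ) • F) ∨ FormTwo σ ((r : ℂ) • F) := by
  have hn : ‖((Real.sqrt r : ℝ) : ℂ)‖ ^ 2 = r := by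
    rw [Complex.norm_real, Real.norm_of_nonneg (Real.sqrt_nonneg r), Real.sq_sqrt hr]
  rcases hF with hF | hF
  · left
    obtain ⟨V, ω, hω, hV, rfl⟩ := (formOne_iff σ hσ F).1 hF
    refine (formOne_iff σ hσ _).2 ⟨((Real.sqrt r : ℝ) : ℂ) • V, ω, hω, ?_, ?_⟩
    · rw [Matrix.mul_smul, hV, Matrix.smul_mul, smul_comm]
    · rw [conjTranspose_smul, kr_smul, kr_smul, norm_star, hn]
      module
  · right
    obtain ⟨V, hV, hV', rfl⟩ := (formTwo_iff σ hσ F).1 hF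
    refine (formTwo_iff σ hσ _).2 ⟨((Real.sqrt r : ℝ) : ℂ) • V, ?_, ?_, ?_⟩
    · rw [Matrix.mul_smul, hV, Matrix.smul_mul]
    · rw [conjTranspose_smul, hV']; simp
    · rw [kr_smul, hn]

/-- for `s ≠ 1/2`, the extremal elements of the cone of CP maps self-adjoint
with respect to `⟨·,·⟩_{δ_s}` are exactly the maps of the two displayed forms, and every
element of the cone is a positive linear combination of maps of these forms. -/
theorem ds_extreme_rays (N : ℕ) (hN : 2 ≤ N) (σ : Mat N) (hσ : σ.PosDef)
    (htr : σ.trace = 1) (s : ℝ) (hs : s ∈ Set.Icc (0:ℝ) 1) (hs' : s ≠ 1/2) :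
    (∀ Φ : Mat N →ₗ[ℂ] Mat N, IsCP Φ → IsDsSelfAdjoint σ hσ s Φ →
      ((∀ Ψ : Mat N →ₗ[ℂ] Mat N, IsCP Ψ → IsDsSelfAdjoint σ hσ s Ψ →
          ∀ t : ℝ, 0 < t → IsCP (Φ - (t : ℂ) • Ψ) →
          ∃ c : ℝ, 0 ≤ c ∧ Ψ = (c : ℂ) • Φ) ↔
        (FormOne σ Φ ∨ FormTwo σ Φ))) ∧
    (∀ Φ : Mat N →ₗ[ℂ] Mat N, IsCP Φ → IsDsSelfAdjoint σ hσ s Φ →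
      ∃ (n : ℕ) (c : Fin n → ℝ) (F : Fin n → (Mat N →ₗ[ℂ] Mat N)),
        (∀ i, 0 ≤ c i) ∧ (∀ i, FormOne σ (F i) ∨ FormTwo σ (F i)) ∧
        Φ = ∑ i, (c i : ℂ) • F i) := by
  refine ⟨fun Φ hcp hsa => ⟨fun hext => ?_, fun hform Ψ hΨ hΨs t ht hle => ?_⟩,
    fun Φ hcp hsa => (dec_main σ hσ s hs' Φ hcp hsa).exists⟩
  · by_cases h0 : Φ = 0
    · right
      exact ⟨0, by simp, by simp, by simp [h0]⟩
    · obtain ⟨c, F, hc, hF0, hF, hle⟩ := (dec_main σ hσ s hs' Φ hcp hsa).exists_le hσ h0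
      obtain ⟨d, hd, hd'⟩ := hext F (form_cp hσ hF) (form_sa hσ s hF) c hc hle
      have hd0 : d ≠ 0 := by
        rintro rfl
        exact hF0 (by simpa using hd')
      have hΦ : Φ = ((d⁻¹ : ℝ) : ℂ) • F := by
        rw [hd', smul_smul, ← Complex.ofReal_mul, inv_mul_cancel₀ hd0]
        simp
      rw [hΦ]
      exact form_smul σ hσ F hF _ (inv_nonneg.2 hd)
  · exact form_extremal σ hσ Φ Ψ hform (dec_main σ hσ s hs' Ψ hΨ hΨs) t ht hle
end
end

section
/- Let u_1,…,u_N be an orthonormal eigenbasis of σ with σ u_j = λ_j u_j, and suppose the N²−N ratios λ_i/λ_j (i ≠ j) are all distinct. Set E_{i,j} = √N |u_i⟩⟨u_j| and for i ≠ j define Ψ_{i,j}(A) = ½(E_{i,j} A E_{i,j} + E_{j,i} A E_{j,i}) if i < j, and Ψ_{i,j}(A) = (1/(2i))(E_{i,j} A E_{i,j} − E_{j,i} A E_{j,i}) if i > j. If Φ is a completely positive map on M_N(ℂ) that is self-adjoint with respect to ⟨·,·⟩_m for every even probability measure m on [0,1], then there exist a completely positive map Φ₀ that is self-adjoint with respect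 to the GNS inner product ⟨B,A⟩_GNS = Tr[B* A σ] and real numbers T_{i,j} (i ≠ j) such that Φ = Φ₀ + Σ_{i≠j} T_{i,j} Ψ_{i,j}. If moreover Φ is unital, then Φ₀ is unital. -/
open MeasureTheory Matrix
open scoped ComplexOrder

noncomputable section

variable {N : ℕ}

/-- `M_m(A) = ∫₀¹ σ^s A σ^{1-s} dm(s)`, defined entrywise. -/
def Mm (σ : Mat N) (hσ : σ.PosDef) (m : Measure ℝ) (A : Mat N) : Mat N :=
  Matrix.of fun i j => ∫ s, (mpow σ hσ s * A * mpow σ hσ (1 - s)) i j ∂m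

/-- The inner product `⟨B,A⟩_m = Tr[Bᴴ M_m(A)]`. -/
def mInner (σ : Mat N) (hσ : σ.PosDef) (m : Measure ℝ) (B A : Mat N) : ℂ :=
  (Bᴴ * Mm σ hσ m A).trace

/-- Self-adjointness with respect to the inner product `⟨·,·⟩_m`. -/
def IsSelfAdjointWrt (σ : Mat N) (hσ : σ.PosDef) (m : Measure ℝ)
    (Φ : Mat N →ₗ[ℂ] Mat N) : Prop :=
  ∀ A B, mInner σ hσ m B (Φ A) = mInner σ hσ m (Φ B) A

/-- The maps `Ψ_{i,j}` built from a matrix-unit system `E`. -/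
def PsiMap (E : Fin N → Fin N → Mat N) (i j : Fin N) (A : Mat N) : Mat N :=
  if i < j then (1/2 : ℂ) • (E i j * A * E i j + E j i * A * E j i)
  else (1/(2 * Complex.I)) • (E i j * A * E i j - E j i * A * E j i)

/-- Self-adjointness with respect to the GNS inner product `⟨B,A⟩ = Tr[Bᴴ A σ]`. -/
def IsGNSSelfAdjoint (σ : Mat N) (Φ : Mat N →ₗ[ℂ] Mat N) : Prop :=
  ∀ A B : Mat N, (Bᴴ * Φ A * σ).trace = ((Φ B)ᴴ * A * σ).trace


lemma mpow_mulVec (σ : Mat N) (hσ : σ.PosDef) (s : ℝ) (v : Fin N → ℂ) (l : ℝ)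
    (hv : σ *ᵥ v = (l : ℂ) • v) : mpow σ hσ s *ᵥ v = ((l ^ s : ℝ) : ℂ) • v := by
  set Q : Mat N := (hσ.1.eigenvectorUnitary : Mat N) with hQ
  have hQ1 : star Q * Q = 1 := Unitary.coe_star_mul_self hσ.1.eigenvectorUnitary
  have hQ2 : Q * star Q = 1 := Unitary.coe_mul_star_self hσ.1.eigenvectorUnitary
  have hspec : σ = Q * diagonal (fun i => ((hσ.1.eigenvalues i : ℝ) : ℂ)) * star Q := by
    have := hσ.1.spectral_theorem
    rw [Unitary.conjStarAlgAut_apply] at this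
    exact this
  have h1 : diagonal (fun i => ((hσ.1.eigenvalues i : ℝ) : ℂ)) *ᵥ (star Q *ᵥ v)
      = (l : ℂ) • (star Q *ᵥ v) := by
    have h2 : star Q *ᵥ (σ *ᵥ v) = (l : ℂ) • (star Q *ᵥ v) := by
      rw [hv, mulVec_smul]
    rw [← h2]
    conv_rhs => rw [hspec]
    simp only [mulVec_mulVec]
    congr 1
    simp only [← Matrix.mul_assoc, hQ1, Matrix.one_mul]
  have h3 : diagonal (fun i => ((hσ.1.eigenvalues i ^ s : ℝ) : ℂ)) *ᵥ (star Q *ᵥ v)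
      = ((l ^ s : ℝ) : ℂ) • (star Q *ᵥ v) := by
    ext k
    have := congrFun h1 k
    simp only [mulVec_diagonal, Pi.smul_apply, smul_eq_mul] at this ⊢
    by_cases hx : (star Q *ᵥ v) k = 0
    · rw [hx]; simp
    · have h4 := mul_right_cancel₀ hx this
      have h5 : hσ.1.eigenvalues k = l := by exact_mod_cast h4
      rw [h5]
  have h6 : mpow σ hσ s *ᵥ v = Q *ᵥ (diagonal (fun i => ((hσ.1.eigenvalues i ^ s : ℝ) : ℂ)) *ᵥ (star Q *ᵥ v)) := by
    simp only [mulVec_mulVec, mpow, ← Matrix.mul_assoc]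
    rfl
  rw [h6, h3, mulVec_smul, mulVec_mulVec, hQ2, one_mulVec]

lemma eq_conj_of_eig (P U : Mat N) (hU : U * Uᴴ = 1) (f : Fin N → ℂ)
    (h : ∀ j, P *ᵥ (fun i => U i j) = f j • (fun i => U i j)) :
    P = U * diagonal f * Uᴴ := by
  have h1 : P * U = U * diagonal f := by
    ext i j
    have := congrFun (h j) i
    rw [mul_diagonal]
    simp only [Pi.smul_apply, smul_eq_mul] at this
    rw [mul_comm, ← this]
    rfl
  rw [← h1, Matrix.mul_assoc, hU, Matrix.mul_one]

lemma trace_formula (U A B : Mat N) (f g : Fin N → ℂ) :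
    (Bᴴ * (U * diagonal f * Uᴴ) * A * (U * diagonal g * Uᴴ)).trace
      = ∑ i, ∑ j, star ((Uᴴ * B * U) i j) * (f i * g j) * (Uᴴ * A * U) i j := by
  have h1 : (Bᴴ * (U * diagonal f * Uᴴ) * A * (U * diagonal g * Uᴴ)).trace
      = ((Uᴴ * B * U)ᴴ * (diagonal f * (Uᴴ * A * U) * diagonal g)).trace := by
    simp only [conjTranspose_mul, conjTranspose_conjTranspose, ← Matrix.mul_assoc]
    rw [trace_mul_comm]
    simp only [← Matrix.mul_assoc]
  rw [h1, trace, Finset.sum_comm]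
  refine Finset.sum_congr rfl fun j _ => ?_
  rw [diag_apply, mul_apply]
  refine Finset.sum_congr rfl fun i _ => ?_
  rw [conjTranspose_apply, mul_diagonal, diagonal_mul]
  ring

lemma mInner_dirac (σ : Mat N) (hσ : σ.PosDef) (s : ℝ) (B A : Mat N) :
    mInner σ hσ (Measure.dirac s) B A = (Bᴴ * mpow σ hσ s * A * mpow σ hσ (1 - s)).trace := by
  have : Mm σ hσ (Measure.dirac s) A = mpow σ hσ s * A * mpow σ hσ (1 - s) := by
    ext i j
    simp only [Mm, of_apply, integral_dirac]
  rw [mInner, this]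
  simp only [Matrix.mul_assoc]

lemma mInner_two (σ : Mat N) (hσ : σ.PosDef) (B A : Mat N) :
    mInner σ hσ ((2⁻¹ : ENNReal) • (Measure.dirac (0:ℝ) + Measure.dirac 1)) B A
      = 2⁻¹ * ((Bᴴ * mpow σ hσ 0 * A * mpow σ hσ 1).trace
        + (Bᴴ * mpow σ hσ 1 * A * mpow σ hσ 0).trace) := by
  have : Mm σ hσ ((2⁻¹ : ENNReal) • (Measure.dirac (0:ℝ) + Measure.dirac 1)) A
      = (2⁻¹ : ℂ) • (mpow σ hσ 0 * A * mpow σ hσ 1 + mpow σ hσ 1 * A * mpow σ hσ 0) := by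
    ext i j
    simp only [Mm, of_apply]
    rw [integral_smul_measure, integral_add_measure, integral_dirac, integral_dirac]
    · simp [mul_add]
    · exact integrable_dirac (by simp)
    · exact integrable_dirac (by simp)
  rw [mInner, this]
  simp only [Matrix.mul_assoc, Matrix.mul_smul, trace_smul, smul_eq_mul, Matrix.mul_add, trace_add]

lemma coord_kraus {M : ℕ} (W : Fin M → Mat N) (X : Mat N) (i j : Fin N) :
    (∑ a, (W a)ᴴ * X * W a) i j = ∑ k, ∑ l, (∑ a, star (W a k i) * W a l j) * X k l := by
  simp only [Matrix.sum_apply, mul_apply, conjTranspose_apply, Finset.sum_mul]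
  rw [Finset.sum_comm]
  conv_rhs => rw [Finset.sum_comm]
  refine Finset.sum_congr rfl fun l _ => ?_
  rw [Finset.sum_comm]
  refine Finset.sum_congr rfl fun k _ => ?_
  refine Finset.sum_congr rfl fun a _ => ?_
  ring

/-- support of the coefficients -/
lemma supp_core {lam : Fin N → ℝ} (hpos : ∀ i, 0 < lam i)
    (hratio : ∀ i j k l : Fin N, i ≠ j → k ≠ l → lam i / lam j = lam k / lam l →
      i = k ∧ j = l) (i j k l : Fin N) (z w : ℂ)
    (h1 : (((lam i) ^ (1/2:ℝ) * (lam j) ^ (1/2:ℝ) : ℝ) : ℂ) * z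
      = w * (((lam k) ^ (1/2:ℝ) * (lam l) ^ (1/2:ℝ) : ℝ) : ℂ))
    (h2 : ((lam i + lam j : ℝ) : ℂ) * z = w * ((lam k + lam l : ℝ) : ℂ)) (hz : z ≠ 0) :
    (i = j ∧ k = l) ∨ (i ≠ j ∧ k = i ∧ l = j) ∨ (i ≠ j ∧ k = j ∧ l = i) := by
  have sq : ∀ a : Fin N, (lam a ^ (1/2:ℝ)) * (lam a ^ (1/2:ℝ)) = lam a := by
    intro a
    rw [← Real.rpow_add (hpos a)]; norm_num
  have inj : ∀ a b, lam a = lam b → a = b := by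
    intro a b hab
    by_contra hne
    have := hratio a b b a hne (Ne.symm hne) (by rw [hab])
    exact hne this.1
  have hi := hpos i
  have hj := hpos j
  have hk := hpos k
  have hl := hpos l
  have key0 : ((lam k + lam l) * (lam i ^ (1/2:ℝ) * lam j ^ (1/2:ℝ)))
      = (lam i + lam j) * (lam k ^ (1/2:ℝ) * lam l ^ (1/2:ℝ)) := by
    have : (((lam k + lam l) * (lam i ^ (1/2:ℝ) * lam j ^ (1/2:ℝ)) : ℝ) : ℂ) * z
      = (((lam i + lam j) * (lam k ^ (1/2:ℝ) * lam l ^ (1/2:ℝ)) : ℝ) : ℂ) * z := by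
      rw [Complex.ofReal_mul, Complex.ofReal_mul (lam i + lam j)]
      linear_combination ((lam k + lam l : ℝ) : ℂ) * h1
        - (((lam k) ^ (1/2:ℝ) * (lam l) ^ (1/2:ℝ) : ℝ) : ℂ) * h2
    exact_mod_cast mul_right_cancel₀ hz this
  have key : (lam k + lam l)^2 * (lam i * lam j) = (lam i + lam j)^2 * (lam k * lam l) := by
    have e : ∀ p q, lam p * lam q = (lam p ^ (1/2:ℝ) * lam q ^ (1/2:ℝ)) ^ 2 := by
      intro p q
      linear_combination -(lam q) * sq p - (lam p ^ (1/2:ℝ) * lam p ^ (1/2:ℝ)) * sq q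
    rw [e i j, e k l, ← mul_pow, ← mul_pow, key0]
  have fac : (lam i * lam l - lam k * lam j) * (lam i * lam k - lam l * lam j) = 0 := by
    linear_combination -key
  have hcase : lam i / lam j = lam k / lam l ∨ lam i / lam j = lam l / lam k := by
    rcases mul_eq_zero.mp fac with h | h
    · left; rw [div_eq_div_iff hj.ne' hl.ne']; linarith
    · right; rw [div_eq_div_iff hj.ne' hk.ne']; linarith
  by_cases hij : i = j
  · left
    refine ⟨hij, ?_⟩
    subst hij
    rw [div_self hi.ne'] at hcase
    apply inj
    rcases hcase with h | h
    · rw [eq_comm, div_eq_one_iff_eq hl.ne'] at h; exact h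
    · rw [eq_comm, div_eq_one_iff_eq hk.ne'] at h; exact h.symm
  · right
    have hkl : k ≠ l := by
      intro hkl
      subst hkl
      apply hij
      apply inj
      rw [div_self hk.ne', or_self, div_eq_one_iff_eq hj.ne'] at hcase
      exact hcase
    rcases hcase with h | h
    · left
      have := hratio i j k l hij hkl h
      exact ⟨hij, this.1.symm, this.2.symm⟩
    · right
      have := hratio i j l k hij hkl.symm h
      exact ⟨hij, this.2.symm, this.1.symm⟩


lemma psi_sum (E : Fin N → Fin N → Mat N) (c : Fin N → Fin N → ℂ)
    (hc : ∀ i j, c i j = star (c j i)) (A : Mat N) :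
    (∑ i, ∑ j, if i = j then 0 else
      ((if i < j then 2 * (c i j).re else 2 * (c j i).im : ℝ) : ℂ) • PsiMap E i j A)
    = ∑ i, ∑ j, if i = j then 0 else c i j • (E i j * A * E i j) := by
  set α : Fin N → Fin N → ℂ := fun i j => if i = j then 0 else
    if i < j then ((c i j).re : ℂ) else ((c j i).im : ℂ) / Complex.I with hα
  set β : Fin N → Fin N → ℂ := fun i j => if i = j then 0 else
    if i < j then ((c i j).re : ℂ) else - (((c j i).im : ℂ) / Complex.I) with hβ
  have h1 : ∀ i j, (if i = j then 0 else
      ((if i < j then 2 * (c i j).re else 2 * (c j i).im : ℝ) : ℂ) • PsiMap E i j A)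
      = α i j • (E i j * A * E i j) + β i j • (E j i * A * E j i) := by
    intro i j
    by_cases hij : i = j
    · simp [hα, hβ, hij]
    · by_cases hlt : i < j
      · simp only [hα, hβ, PsiMap, if_neg hij, if_pos hlt, smul_smul, ← smul_add]
        congr 1
        push_cast
        ring
      · simp only [hα, hβ, PsiMap, if_neg hij, if_neg hlt, smul_smul, neg_smul, ← sub_eq_add_neg,
          ← smul_sub]
        congr 1
        push_cast
        field_simp
  simp only [h1, Finset.sum_add_distrib]
  rw [Finset.sum_comm (f := fun i j => β i j • (E j i * A * E j i))]
  simp only [← Finset.sum_add_distrib, ← add_smul]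
  refine Finset.sum_congr rfl fun i _ => Finset.sum_congr rfl fun j _ => ?_
  by_cases hij : i = j
  · simp [hα, hβ, hij]
  · rw [if_neg hij]
    congr 1
    rcases lt_or_gt_of_ne hij with h | h
    · simp only [hα, hβ, if_neg hij, if_neg (Ne.symm hij), if_pos h, if_neg (not_lt_of_gt h)]
      apply Complex.ext <;> simp
    · simp only [hα, hβ, if_neg hij, if_neg (Ne.symm hij), if_pos h, if_neg (not_lt_of_gt h)]
      rw [hc i j]
      apply Complex.ext <;> simp

/-- Kraus operators (in the eigenbasis) of the GNS part -/
def Lop {M : ℕ} (W : Fin M → Mat N) : Fin M × Option (Fin N × Fin N) → Mat N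
  | (a, none) => diagonal (fun i => W a i i)
  | (a, some (i, k)) => if i = k then 0 else Matrix.single i k (W a i k)

lemma Lop_coord {M : ℕ} (W : Fin M → Mat N) (X : Mat N) (i j : Fin N) :
    (∑ κ, (Lop W κ)ᴴ * X * Lop W κ) i j =
      if i = j then ∑ k, (∑ a, star (W a k i) * W a k i) * X k k
      else (∑ a, star (W a i i) * W a j j) * X i j := by
  have h0 : ∀ a, ((Lop W (a, none))ᴴ * X * Lop W (a, none)) i j
      = star (W a i i) * W a j j * X i j := by
    intro a
    simp only [Lop, diagonal_conjTranspose, mul_diagonal, diagonal_mul, Pi.star_apply]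
    ring
  have h1 : ∀ a k l, ((Lop W (a, some (k, l)))ᴴ * X * Lop W (a, some (k, l))) i j
      = if i = l then (if i = j then (if k = i then 0 else star (W a k i) * W a k i * X k k)
          else 0) else 0 := by
    intro a k l
    simp only [Lop]
    by_cases hkl : k = l
    · rw [if_pos hkl]
      split_ifs with h2 h3 h4 <;> simp_all
    · rw [if_neg hkl, conjTranspose_single, single_mul_mul_single, single_apply]
      by_cases h2 : i = l
      · subst h2
        by_cases h3 : i = j
        · subst h3
          simp [hkl]
          ring
        · simp [h3]
      · simp [h2, Ne.symm h2]
  rw [Matrix.sum_apply, Fintype.sum_prod_type]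
  simp only [Fintype.sum_option, Fintype.sum_prod_type, h0, h1, Finset.sum_ite_eq,
    Finset.mem_univ, if_true]
  by_cases hij : i = j
  · subst hij
    simp only [if_true, Finset.sum_mul]
    rw [Finset.sum_comm]
    refine Finset.sum_congr rfl fun a _ => ?_
    rw [← Finset.add_sum_erase _ _ (Finset.mem_univ i),
      ← Finset.add_sum_erase (a := i) _ (fun k => star (W a k i) * W a k i * X k k) (Finset.mem_univ i)]
    rw [if_pos rfl, zero_add]
    congr 1
    refine Finset.sum_congr rfl fun k hk => ?_
    rw [if_neg (Finset.ne_of_mem_erase hk)]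
  · simp only [if_neg hij, Finset.sum_const_zero, add_zero, Finset.sum_mul]

/-- linear map attached to a finite family of Kraus operators -/
def krausMap {ι : Type} [Fintype ι] (K : ι → Mat N) : Mat N →ₗ[ℂ] Mat N :=
  ∑ κ, (LinearMap.mulRight ℂ (K κ)).comp (LinearMap.mulLeft ℂ (K κ)ᴴ)

lemma krausMap_apply {ι : Type} [Fintype ι] (K : ι → Mat N) (A : Mat N) :
    krausMap K A = ∑ κ, (K κ)ᴴ * A * K κ := by
  simp [krausMap]

lemma krausMap_cp {ι : Type} [Fintype ι] (K : ι → Mat N) : IsCP (krausMap K) := by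
  refine ⟨Fintype.card ι, fun x => K ((Fintype.equivFin ι).symm x), fun A => ?_⟩
  rw [krausMap_apply]
  exact ((Fintype.equivFin ι).symm.sum_comp (fun κ => (K κ)ᴴ * A * K κ)).symm

lemma conj_kraus {ι : Type} [Fintype ι] (U : Mat N) (hU : U * Uᴴ = 1) (K : ι → Mat N) (A : Mat N) :
    Uᴴ * (∑ κ, (K κ)ᴴ * A * K κ) * U
      = ∑ κ, (Uᴴ * K κ * U)ᴴ * (Uᴴ * A * U) * (Uᴴ * K κ * U) := by
  rw [Finset.mul_sum, Finset.sum_mul]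
  refine Finset.sum_congr rfl fun κ _ => ?_
  have h : ∀ X : Mat N, U * (Uᴴ * X) = X := fun X => by
    rw [← Matrix.mul_assoc, hU, Matrix.one_mul]
  simp only [conjTranspose_mul, conjTranspose_conjTranspose, Matrix.mul_assoc, h]

/-- if the modular operator has minimally degenerate spectrum (all ratios
`λ_i/λ_j`, `i ≠ j`, distinct) and `Φ` is CP and self-adjoint with respect to `⟨·,·⟩_m` for
every even probability measure `m` on `[0,1]`, then `Φ = Φ₀ + Σ_{i≠j} T_{ij} Ψ_{ij}` with
`Φ₀` CP and GNS self-adjoint and `T` real; and `Φ₀` is unital whenever `Φ` is. -/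
theorem evenly_selfAdjoint_decomposition (N : ℕ) (hN : 2 ≤ N) (σ : Mat N)
    (hσ : σ.PosDef) (htr : σ.trace = 1)
    (u : Fin N → (Fin N → ℂ)) (lam : Fin N → ℝ) (hpos : ∀ i, 0 < lam i)
    (horth : ∀ i j, star (u i) ⬝ᵥ u j = if i = j then 1 else 0)
    (heig : ∀ j, σ *ᵥ u j = (lam j : ℂ) • u j)
    (hratio : ∀ i j k l : Fin N, i ≠ j → k ≠ l → lam i / lam j = lam k / lam l →
      i = k ∧ j = l)
    (E : Fin N → Fin N → Mat N)
    (hE : ∀ i j, E i j = (Real.sqrt N : ℂ) • Matrix.vecMulVec (u i) (star (u j)))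
    (Φ : Mat N →ₗ[ℂ] Mat N) (hΦcp : IsCP Φ)
    (hΦsa : ∀ m : Measure ℝ, IsProbabilityMeasure m → m (Set.Icc (0:ℝ) 1)ᶜ = 0 →
      m.map (fun s => 1 - s) = m → IsSelfAdjointWrt σ hσ m Φ) :
    ∃ (Φ₀ : Mat N →ₗ[ℂ] Mat N) (T : Fin N → Fin N → ℝ),
      IsCP Φ₀ ∧ IsGNSSelfAdjoint σ Φ₀ ∧
      (∀ A, Φ A = Φ₀ A + ∑ i, ∑ j, if i = j then 0 else (T i j : ℂ) • PsiMap E i j A) ∧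
      (Φ 1 = 1 → Φ₀ 1 = 1) := by
  set U : Mat N := Matrix.of fun i j => u j i with hUdef
  have hU1 : Uᴴ * U = 1 := by
    ext i j
    rw [mul_apply, one_apply, ← horth i j]
    rfl
  have hU2 : U * Uᴴ = 1 := mul_eq_one_comm.mp hU1
  have hmp : ∀ s : ℝ, mpow σ hσ s = U * diagonal (fun i => ((lam i ^ s : ℝ) : ℂ)) * Uᴴ := by
    intro s
    apply eq_conj_of_eig _ U hU2
    intro j
    exact mpow_mulVec σ hσ s (u j) (lam j) (heig j)
  have hσU : σ = U * diagonal (fun i => (lam i : ℂ)) * Uᴴ := by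
    apply eq_conj_of_eig _ U hU2
    intro j
    exact heig j
  have hcancel : ∀ X : Mat N, Uᴴ * (U * X * Uᴴ) * U = X := by
    intro X
    calc Uᴴ * (U * X * Uᴴ) * U = (Uᴴ * U) * X * (Uᴴ * U) := by simp only [Matrix.mul_assoc]
      _ = X := by rw [hU1, Matrix.one_mul, Matrix.mul_one]
  have hinj : ∀ X Y : Mat N, (∀ i j, (Uᴴ * X * U) i j = (Uᴴ * Y * U) i j) → X = Y := by
    intro X Y h
    have h1 : Uᴴ * X * U = Uᴴ * Y * U := by ext i j; exact h i j
    have h2 : ∀ Z : Mat N, U * (Uᴴ * Z * U) * Uᴴ = Z := by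
      intro Z
      calc U * (Uᴴ * Z * U) * Uᴴ = (U * Uᴴ) * Z * (U * Uᴴ) := by simp only [Matrix.mul_assoc]
        _ = Z := by rw [hU2, Matrix.one_mul, Matrix.mul_one]
    rw [← h2 X, h1, h2]
  obtain ⟨M, V, hV⟩ := hΦcp
  set W : Fin M → Mat N := fun a => Uᴴ * V a * U with hW
  set φ : Fin N → Fin N → Fin N → Fin N → ℂ :=
    fun i j k l => ∑ a, star (W a k i) * W a l j with hφ
  have hcoord : ∀ A i j, (Uᴴ * Φ A * U) i j = ∑ k, ∑ l, φ i j k l * (Uᴴ * A * U) k l := by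
    intro A i j
    rw [hV, conj_kraus U hU2, coord_kraus]
  have hunit : ∀ i j k l, (Uᴴ * Φ (U * single k l 1 * Uᴴ) * U) i j = φ i j k l := by
    intro i j k l
    rw [hcoord, hcancel]
    rw [Finset.sum_eq_single k, Finset.sum_eq_single l]
    · simp
    · intro b _ hb; simp [single_apply, hb.symm]
    · simp
    · intro b _ hb
      apply Finset.sum_eq_zero
      intro c _
      simp [single_apply, hb.symm]
    · simp
  have hsingle : ∀ (k l : Fin N) (F : Fin N → Fin N → ℂ),
      ∑ i, ∑ j, F i j * (single k l (1:ℂ) : Mat N) i j = F k l := by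
    intro k l F
    rw [Finset.sum_eq_single k, Finset.sum_eq_single l]
    · simp
    · intro b _ hb; simp [single_apply, hb.symm]
    · simp
    · intro b _ hb
      apply Finset.sum_eq_zero
      intro c _
      simp [single_apply, hb.symm]
    · simp
  have htrL : ∀ (s t : ℝ) (i j k l : Fin N),
      ((U * single i j 1 * Uᴴ)ᴴ * mpow σ hσ s * Φ (U * single k l 1 * Uᴴ) * mpow σ hσ t).trace
        = (((lam i) ^ s * (lam j) ^ t : ℝ) : ℂ) * φ i j k l := by
    intro s t i j k l
    rw [hmp, hmp, trace_formula, hcancel]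
    simp only [hunit]
    rw [← hsingle i j (fun i j => (((lam i) ^ s * (lam j) ^ t : ℝ) : ℂ) * φ i j k l)]
    refine Finset.sum_congr rfl fun p _ => Finset.sum_congr rfl fun q _ => ?_
    have : star ((single i j (1:ℂ) : Mat N) p q) = (single i j (1:ℂ) : Mat N) p q := by
      rw [single_apply]; split_ifs <;> simp
    rw [this]
    push_cast
    ring
  have htrR : ∀ (s t : ℝ) (i j k l : Fin N),
      ((Φ (U * single i j 1 * Uᴴ))ᴴ * mpow σ hσ s * (U * single k l 1 * Uᴴ) * mpow σ hσ t).trace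
        = star (φ k l i j) * (((lam k) ^ s * (lam l) ^ t : ℝ) : ℂ) := by
    intro s t i j k l
    rw [hmp, hmp, trace_formula, hcancel]
    simp only [hunit]
    rw [hsingle k l]
    push_cast
    ring
  have hmd : ∀ x : ℝ, Measure.map (fun s : ℝ => 1 - s) (Measure.dirac x) = Measure.dirac (1 - x) :=
    fun x => Measure.map_dirac' (measurable_const.sub measurable_id) x
  have H1 : ∀ i j k l, (((lam i) ^ (1/2:ℝ) * (lam j) ^ (1/2:ℝ) : ℝ) : ℂ) * φ i j k l
      = star (φ k l i j) * (((lam k) ^ (1/2:ℝ) * (lam l) ^ (1/2:ℝ) : ℝ) : ℂ) := by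
    intro i j k l
    have h := hΦsa (Measure.dirac (1/2)) inferInstance
      (by rw [Measure.dirac_apply' _ measurableSet_Icc.compl]; simp; norm_num)
      (by rw [hmd]; norm_num)
      (U * single k l 1 * Uᴴ) (U * single i j 1 * Uᴴ)
    rw [mInner_dirac, mInner_dirac, show (1 - 1/2 : ℝ) = 1/2 by norm_num, htrL, htrR] at h
    exact h
  have H2 : ∀ i j k l, ((lam i + lam j : ℝ) : ℂ) * φ i j k l
      = star (φ k l i j) * ((lam k + lam l : ℝ) : ℂ) := by
    intro i j k l
    have h := hΦsa ((2⁻¹ : ENNReal) • (Measure.dirac (0:ℝ) + Measure.dirac 1))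
      ⟨by
        simp only [Measure.smul_apply, Measure.add_apply, measure_univ, smul_eq_mul]
        rw [one_add_one_eq_two]
        exact ENNReal.inv_mul_cancel (by norm_num) (by norm_num)⟩
      (by
        simp only [Measure.smul_apply, Measure.add_apply,
          Measure.dirac_apply' _ measurableSet_Icc.compl]
        simp)
      (by
        rw [Measure.map_smul, Measure.map_add _ _ (by fun_prop),
          hmd, hmd, add_comm]
        norm_num)
      (U * single k l 1 * Uᴴ) (U * single i j 1 * Uᴴ)
    rw [mInner_two, mInner_two, htrL, htrL, htrR, htrR] at h
    simp only [Real.rpow_zero, Real.rpow_one, one_mul, mul_one] at h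
    push_cast at h ⊢
    linear_combination 2 * h
  have hsupp := fun i j k l => supp_core hpos hratio i j k l (φ i j k l) _ (H1 i j k l) (H2 i j k l)
  have hpp : ∀ i k, (lam i : ℂ) * φ i i k k = star (φ k k i i) * (lam k : ℂ) := by
    intro i k
    have := H2 i i k k
    push_cast at this
    linear_combination this / 2
  have hq : ∀ i j, φ i j i j = star (φ i j i j) := by
    intro i j
    have := H2 i j i j
    rw [mul_comm] at this
    refine mul_right_cancel₀ ?_ this
    exact_mod_cast (add_pos (hpos i) (hpos j)).ne'
  have hc : ∀ i j, φ i j j i = star (φ j i i j) := by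
    intro i j
    have := H2 i j j i
    rw [mul_comm, add_comm (lam j)] at this
    refine mul_right_cancel₀ ?_ this
    exact_mod_cast (add_pos (hpos i) (hpos j)).ne'
  have hΦc : ∀ A i j, (Uᴴ * Φ A * U) i j =
      (if i = j then ∑ k, φ i i k k * (Uᴴ * A * U) k k else φ i j i j * (Uᴴ * A * U) i j)
      + (if i = j then 0 else φ i j j i * (Uᴴ * A * U) j i) := by
    intro A i j
    rw [hcoord]
    by_cases hij : i = j
    · subst hij
      simp only [if_true, add_zero]
      refine Finset.sum_congr rfl fun k _ => ?_
      rw [Finset.sum_eq_single k]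
      · intro l _ hl
        have : φ i i k l = 0 := by
          by_contra hne
          rcases hsupp i i k l hne with h | h | h
          · exact hl h.2.symm
          · exact h.1 rfl
          · exact h.1 rfl
        rw [this, zero_mul]
      · simp
    · simp only [if_neg hij]
      have hz : ∀ k l, ¬ (k = i ∧ l = j) → ¬ (k = j ∧ l = i) → φ i j k l = 0 := by
        intro k l h1 h2
        by_contra hne
        rcases hsupp i j k l hne with h | h | h
        · exact hij h.1
        · exact h1 h.2
        · exact h2 h.2
      rw [Fintype.sum_eq_add i j hij, Finset.sum_eq_single j, Finset.sum_eq_single i]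
      · intro l _ hl
        rw [hz j l (fun h => hij h.1.symm) (fun h => hl h.2), zero_mul]
      · simp
      · intro l _ hl
        rw [hz i l (fun h => hl h.2) (fun h => hij h.1), zero_mul]
      · simp
      · intro k hk
        apply Finset.sum_eq_zero
        intro l _
        rw [hz k l (fun h => hk.1 h.1) (fun h => hk.2 h.1), zero_mul]
  set Φ₀ := krausMap (fun κ => U * Lop W κ * Uᴴ) with hΦ₀
  have hΦ₀c : ∀ A i j, (Uᴴ * Φ₀ A * U) i j =
      (if i = j then ∑ k, φ i i k k * (Uᴴ * A * U) k k else φ i j i j * (Uᴴ * A * U) i j) := by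
    intro A i j
    rw [hΦ₀, krausMap_apply, conj_kraus U hU2]
    simp only [hcancel]
    rw [Lop_coord]
  have hNpos : (N : ℂ) ≠ 0 := by
    have : N ≠ 0 := by omega
    exact_mod_cast this
  have hEU : ∀ i j, E i j = (Real.sqrt N : ℂ) • (U * single i j 1 * Uᴴ) := by
    intro i j
    rw [hE]
    congr 1
    ext p q
    rw [vecMulVec_apply, mul_apply, Finset.sum_eq_single j]
    · simp [mul_apply, single_apply, hUdef]
    · intro b _ hb
      simp [mul_apply, single_apply, hb.symm]
    · simp
  have hsq : (Real.sqrt N : ℂ) * (Real.sqrt N : ℂ) = N := by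
    rw [← Complex.ofReal_mul, Real.mul_self_sqrt (Nat.cast_nonneg N)]
    simp
  have hEAE : ∀ A i j, Uᴴ * (E i j * A * E i j) * U
      = (N : ℂ) • single i j ((Uᴴ * A * U) j i) := by
    intro A i j
    have : Uᴴ * (E i j * A * E i j) * U
        = (N : ℂ) • ((Uᴴ * U) * single i j 1 * (Uᴴ * A * U) * single i j 1 * (Uᴴ * U)) := by
      rw [hEU, ← hsq]
      simp only [Matrix.smul_mul, Matrix.mul_smul, smul_smul, Matrix.mul_assoc]
    rw [this, hU1, Matrix.one_mul, Matrix.mul_one, single_mul_mul_single]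
    simp
  set c : Fin N → Fin N → ℂ := fun i j => φ i j j i / N with hcdef
  have hcc : ∀ i j, c i j = star (c j i) := by
    intro i j
    simp only [hcdef]
    rw [hc i j]
    simp
  have hdec : ∀ A, Φ A = Φ₀ A + ∑ i, ∑ j, if i = j then 0 else c i j • (E i j * A * E i j) := by
    intro A
    apply hinj
    intro p q
    rw [Matrix.mul_add, Matrix.add_mul, Matrix.add_apply, hΦc, hΦ₀c]
    congr 1
    have : Uᴴ * (∑ i, ∑ j, if i = j then 0 else c i j • (E i j * A * E i j)) * U
        = ∑ i, ∑ j, if i = j then 0 else (c i j * N) • single i j ((Uᴴ * A * U) j i) := by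
      simp only [Finset.mul_sum, Finset.sum_mul]
      refine Finset.sum_congr rfl fun i _ => Finset.sum_congr rfl fun j _ => ?_
      split_ifs
      · simp
      · rw [Matrix.mul_smul, Matrix.smul_mul, hEAE, smul_smul]
    rw [this]
    simp only [Matrix.sum_apply]
    rw [Finset.sum_eq_single p, Finset.sum_eq_single q]
    · split_ifs with h
      · simp
      · simp [hcdef, hNpos]
    · intro b _ hb
      split_ifs
      · simp
      · simp [single_apply, hb]
    · simp
    · intro b _ hb
      apply Finset.sum_eq_zero
      intro d _
      split_ifs
      · simp
      · simp [single_apply, hb]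
    · simp
  refine ⟨Φ₀, fun i j => if i < j then 2 * (c i j).re else 2 * (c j i).im,
    krausMap_cp _, ?_, ?_, ?_⟩
  · intro A B
    have hone : ∀ X Y : Mat N, (Xᴴ * Y * σ).trace
        = ∑ i, ∑ j, star ((Uᴴ * X * U) i j) * (lam j : ℂ) * (Uᴴ * Y * U) i j := by
      intro X Y
      have h := trace_formula U Y X (fun _ => 1) (fun i => (lam i : ℂ))
      rw [← hσU] at h
      simp only [diagonal_one, Matrix.mul_one, hU2, one_mul] at h
      exact h
    rw [hone, hone]
    simp only [hΦ₀c]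
    have hsplit : ∀ F : Fin N → Fin N → ℂ, ∑ i, ∑ j, F i j
        = ∑ i, F i i + ∑ i, ∑ j, if i = j then 0 else F i j := by
      intro F
      rw [← Finset.sum_add_distrib]
      refine Finset.sum_congr rfl fun i _ => ?_
      rw [← Finset.add_sum_erase _ _ (Finset.mem_univ i),
        ← Finset.add_sum_erase (a := i) _ (fun j => if i = j then 0 else F i j) (Finset.mem_univ i)]
      rw [if_pos rfl, zero_add]
      congr 1
      refine Finset.sum_congr rfl fun j hj => ?_
      rw [if_neg (Finset.ne_of_mem_erase hj).symm]
    refine (hsplit _).trans (Eq.trans ?_ (hsplit _).symm)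
    congr 1
    · simp only [if_true, star_sum, Finset.mul_sum, Finset.sum_mul]
      rw [Finset.sum_comm]
      refine Finset.sum_congr rfl fun i _ => Finset.sum_congr rfl fun k _ => ?_
      rw [star_mul']
      have := hpp k i
      linear_combination star ((Uᴴ * B * U) k k) * (Uᴴ * A * U) i i * this
    · refine Finset.sum_congr rfl fun i _ => Finset.sum_congr rfl fun j _ => ?_
      split_ifs with h
      · rfl
      · rw [star_mul', ← hq]
        ring
  · intro A
    rw [hdec A, ← psi_sum E c hcc A]
  · intro h1
    have h2 := hdec 1
    have h3 : (∑ i, ∑ j, if i = j then 0 else c i j • (E i j * (1 : Mat N) * E i j)) = 0 := by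
      apply Finset.sum_eq_zero; intro i _
      apply Finset.sum_eq_zero; intro j _
      split_ifs with h
      · rfl
      · have : E i j * (1 : Mat N) * E i j = 0 := by
          apply hinj
          intro p q
          rw [hEAE, Matrix.mul_one, hU1, one_apply_ne (Ne.symm h)]
          simp
        rw [this, smul_zero]
    rw [h3, add_zero, h1] at h2
    exact h2.symm
end
end
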